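/- arXiv:0910.1263 — 4 statements merged into one kernel-verified Lean document; each statement's English description precedes it below -/
import Mathlib

section
/- Let a(n) be the cubic partition function. Then for every nonnegative integer n, a(49n+36) ≡ 0 (mod 7). -/
/-- The cubic partition function: number of pairs of partitions (λ, μ) with
|λ| + |μ| = n where all parts of μ are even. -/
def cubicPartition (n : ℕ) : ℕ :=
  ∑ j ∈ Finset.range (n + 1),
    Fintype.card (Nat.Partition j) *
      Fintype.card {μ : Nat.Partition (n - j) // ∀ i ∈ μ.parts, Even i}

namespace CubicPartition

open Finset

section JacobiTripleProduct

variable {R : Type*} [CommRing R]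

/-- The Gaussian binomial coefficient `[m + n choose n]` at `q`. -/
def gaussBinom (q : R) : ℕ → ℕ → R
  | 0, _ => 1
  | _ + 1, 0 => 1
  | m + 1, n + 1 => gaussBinom q m (n + 1) + q ^ (m + 1) * gaussBinom q (m + 1) n

@[simp]
lemma gaussBinom_zero_left (q : R) (n : ℕ) : gaussBinom q 0 n = 1 := by
  cases n <;> simp [gaussBinom]

@[simp]
lemma gaussBinom_zero_right (q : R) (m : ℕ) : gaussBinom q m 0 = 1 := by
  cases m <;> simp [gaussBinom]

lemma gaussBinom_succ_succ (q : R) (m n : ℕ) :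
    gaussBinom q (m + 1) (n + 1) =
      gaussBinom q m (n + 1) + q ^ (m + 1) * gaussBinom q (m + 1) n := by
  rw [gaussBinom]

lemma one_sub_pow_mul_gaussBinom (q : R) (m n : ℕ) :
    (1 - q ^ (n + 1)) * gaussBinom q m (n + 1) = (1 - q ^ (m + n + 1)) * gaussBinom q m n ∧
      (1 - q ^ (m + 1)) * gaussBinom q (m + 1) n = (1 - q ^ (m + n + 1)) * gaussBinom q m n := by
  induction m generalizing n with
  | zero =>
    refine ⟨by simp, ?_⟩
    induction n with
    | zero => simp
    | succ n ih =>
      rw [gaussBinom_succ_succ]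
      simp only [gaussBinom_zero_left, zero_add, pow_one] at ih ⊢
      linear_combination q * ih
  | succ m ihm =>
    induction n with
    | zero =>
      obtain ⟨h1, h2⟩ := ihm 0
      rw [gaussBinom_succ_succ]
      simp only [gaussBinom_zero_right, zero_add, pow_one, add_zero] at h1 h2 ⊢
      exact ⟨by linear_combination h1, trivial⟩
    | succ n ihn =>
      obtain ⟨h1, h2⟩ := ihm (n + 1)
      obtain ⟨h3, h4⟩ := ihn
      rw [gaussBinom_succ_succ q m (n + 1), gaussBinom_succ_succ q (m + 1) n]
      exact ⟨by linear_combination h1 - h2, by linear_combination q ^ (m + 2) * (h4 - h3)⟩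

lemma gaussBinom_succ_succ' (q : R) (m n : ℕ) :
    gaussBinom q (m + 1) (n + 1) =
      q ^ (n + 1) * gaussBinom q m (n + 1) + gaussBinom q (m + 1) n := by
  obtain ⟨h1, h2⟩ := one_sub_pow_mul_gaussBinom q m n
  rw [gaussBinom_succ_succ]
  linear_combination h1 - h2

lemma gaussBinom_comm (q : R) (m n : ℕ) : gaussBinom q m n = gaussBinom q n m := by
  induction m generalizing n with
  | zero => simp
  | succ m ihm =>
    induction n with
    | zero => simp
    | succ n ihn => rw [gaussBinom_succ_succ, gaussBinom_succ_succ', ihm, ihn, add_comm]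

lemma gaussBinom_mul_prod (q : R) (m n : ℕ) :
    gaussBinom q m n * ∏ i ∈ range n, (1 - q ^ (i + 1)) =
      ∏ i ∈ range n, (1 - q ^ (m + i + 1)) := by
  induction n with
  | zero => simp
  | succ n ih =>
    rw [prod_range_succ, prod_range_succ, ← ih]
    linear_combination (∏ i ∈ range n, (1 - q ^ (i + 1))) * (one_sub_pow_mul_gaussBinom q m n).1

/-- The Gaussian binomial coefficient, extended by zero to integer arguments. -/
def gaussBinomInt (q : R) (a b : ℤ) : R :=
  if a < 0 ∨ b < 0 then 0 else gaussBinom q a.toNat b.toNat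

lemma gaussBinomInt_comm (q : R) (a b : ℤ) : gaussBinomInt q a b = gaussBinomInt q b a := by
  simp only [gaussBinomInt, or_comm, gaussBinom_comm]

lemma gaussBinomInt_of_neg_left (q : R) {a : ℤ} (b : ℤ) (ha : a < 0) :
    gaussBinomInt q a b = 0 := by
  simp [gaussBinomInt, ha]

lemma gaussBinomInt_natCast (q : R) (m n : ℕ) : gaussBinomInt q m n = gaussBinom q m n := by
  rw [gaussBinomInt, if_neg (by omega), Int.toNat_natCast, Int.toNat_natCast]

lemma gaussBinomInt_rec (q : R) {a b : ℤ} (h : 0 < a + b) :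
    gaussBinomInt q a b =
      gaussBinomInt q (a - 1) b + q ^ a.toNat * gaussBinomInt q a (b - 1) := by
  rcases lt_or_ge a 0 with ha | ha
  · simp [gaussBinomInt, ha, show a - 1 < 0 by omega]
  rcases lt_or_ge b 0 with hb | hb
  · simp [gaussBinomInt, hb, show b - 1 < 0 by omega]
  lift a to ℕ using ha
  lift b to ℕ using hb
  have hsub (k : ℕ) : ((k + 1 : ℕ) : ℤ) - 1 = k := by push_cast; ring
  have hneg : ((0 : ℕ) : ℤ) - 1 < 0 := by norm_num
  match a, b with
  | 0, 0 => simp at h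
  | 0, b + 1 =>
    rw [gaussBinomInt_of_neg_left q _ hneg, hsub, gaussBinomInt_natCast, gaussBinomInt_natCast]
    simp
  | a + 1, 0 =>
    rw [gaussBinomInt_comm q _ (_ - 1), gaussBinomInt_of_neg_left q _ hneg, hsub,
      gaussBinomInt_natCast, gaussBinomInt_natCast]
    simp
  | a + 1, b + 1 =>
    rw [hsub, hsub, gaussBinomInt_natCast, gaussBinomInt_natCast, gaussBinomInt_natCast,
      Int.toNat_natCast, gaussBinom_succ_succ]

/-- The triangular number `j (j + 1) / 2` of an integer. -/
def triangle (j : ℤ) : ℕ := (j * (j + 1) / 2).toNat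

lemma two_mul_triangle (j : ℤ) : 2 * (triangle j : ℤ) = j * (j + 1) := by
  have h : 0 ≤ j * (j + 1) := by
    rcases lt_or_ge j 0 with hj | hj
    · nlinarith
    · positivity
  have h2 := Int.two_dvd_mul_add_one j
  rw [triangle, Int.toNat_of_nonneg (by omega)]
  omega

/-- The general term of Ramanujan's theta function `f(α, β)`. -/
def thetaTerm (α β : R) (j : ℤ) : R := α ^ triangle j * β ^ triangle (-j)

lemma thetaTerm_neg (α β : R) (j : ℤ) : thetaTerm α β (-j) = thetaTerm β α j := by
  simp [thetaTerm, mul_comm]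

lemma thetaTerm_add_one (α β : R) {j : ℤ} (hj : 0 ≤ j) :
    thetaTerm α β (j + 1) = α * (α * β) ^ j.toNat * thetaTerm α β j := by
  have h1 := two_mul_triangle j
  have h2 := two_mul_triangle (j + 1)
  have h3 := two_mul_triangle (-j)
  have h4 := two_mul_triangle (-(j + 1))
  have e1 : triangle (j + 1) = j.toNat + 1 + triangle j := by
    zify; rw [Int.toNat_of_nonneg hj]; linarith
  have e2 : triangle (-(j + 1)) = j.toNat + triangle (-j) := by
    zify; rw [Int.toNat_of_nonneg hj]; linarith
  rw [thetaTerm, thetaTerm, e1, e2]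
  ring

lemma thetaTerm_step (α β : R) {m j : ℤ} (hm : 0 ≤ m) (hj : j ≤ m) :
    α * (α * β) ^ m.toNat * thetaTerm α β j =
      (α * β) ^ (m - j).toNat * thetaTerm α β (j + 1) := by
  rcases lt_or_ge j 0 with h | h
  · have := thetaTerm_add_one β α (j := -j - 1) (by omega)
    rw [show -j - 1 + 1 = -j by ring, thetaTerm_neg, show -j - 1 = -(j + 1) by ring,
      thetaTerm_neg, show -(j + 1) = -j - 1 by ring] at this
    rw [this, show (m - j).toNat = m.toNat + (-j - 1).toNat + 1 by omega]
    ring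
  · rw [thetaTerm_add_one α β h, show m.toNat = (m - j).toNat + j.toNat by omega]
    ring

/-- The finite form of the two-sided theta sum. -/
noncomputable def finiteTheta (α β : R) (m n : ℕ) : R :=
  ∑ᶠ j : ℤ, gaussBinomInt (α * β) (m - j) (n + j) * thetaTerm α β j

lemma support_finiteTheta_subset (α β : R) (m n : ℕ) :
    (Function.support fun j : ℤ ↦ gaussBinomInt (α * β) (m - j) (n + j) * thetaTerm α β j) ⊆
      Icc (-n : ℤ) m := by
  intro j hj
  contrapose! hj
  have : (m : ℤ) - j < 0 ∨ (n : ℤ) + j < 0 := by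
    simp only [coe_Icc, Set.mem_Icc, not_and_or, not_le] at hj
    omega
  simp only [Function.mem_support, not_not, gaussBinomInt, if_pos this, zero_mul]

lemma finiteTheta_comm (α β : R) (m n : ℕ) : finiteTheta α β m n = finiteTheta β α n m := by
  rw [finiteTheta, finiteTheta, ← finsum_comp_equiv (Equiv.neg ℤ)]
  refine finsum_congr fun j ↦ ?_
  rw [Equiv.neg_apply, thetaTerm_neg, gaussBinomInt_comm, mul_comm α β]
  rw [sub_neg_eq_add, ← sub_eq_add_neg]

lemma finiteTheta_succ_left (α β : R) (m n : ℕ) :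
    finiteTheta α β (m + 1) n = (1 + α * (α * β) ^ m) * finiteTheta α β m n := by
  set u : ℤ → R := fun j ↦ gaussBinomInt (α * β) (m - j) (n + j) * thetaTerm α β j with hu
  have hfin : u.support.Finite :=
    (finite_toSet _).subset (support_finiteTheta_subset α β m n)
  have hfin' : (Function.support fun j ↦ α * (α * β) ^ m * u (j - 1)).Finite :=
    (hfin.preimage (f := fun j : ℤ ↦ j - 1) (sub_left_injective.injOn)).subset
      (fun j hj hj' ↦ hj (by simp only [hj', mul_zero]))
  have hshift : ∑ᶠ j, u (j - 1) = ∑ᶠ j, u j := finsum_comp_equiv (Equiv.subRight (1 : ℤ))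
  have hstep (j : ℤ) : gaussBinomInt (α * β) ((m + 1 : ℕ) - j) (n + j) * thetaTerm α β j =
      u j + α * (α * β) ^ m * u (j - 1) := by
    have hrec := gaussBinomInt_rec (α * β) (a := (m + 1 : ℕ) - j) (b := n + j) (by omega)
    rw [show ((m + 1 : ℕ) : ℤ) - j - 1 = m - j by push_cast; ring] at hrec
    simp only [hu]
    rw [show (m : ℤ) - (j - 1) = (m + 1 : ℕ) - j by push_cast; ring, ← add_sub_assoc, hrec,
      add_mul]
    congr 1
    rcases lt_or_ge (m : ℤ) (j - 1) with hj | hj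
    · rw [gaussBinomInt_of_neg_left (α * β) (a := (m + 1 : ℕ) - j) _ (by omega)]
      simp
    · have := thetaTerm_step α β (by omega) hj
      rw [sub_add_cancel, Int.toNat_natCast,
        show (m : ℤ) - (j - 1) = (m + 1 : ℕ) - j by push_cast; ring] at this
      linear_combination -(gaussBinomInt (α * β) ((m + 1 : ℕ) - j) (n + j - 1)) * this
  rw [finiteTheta, finsum_congr hstep, finsum_add_distrib hfin hfin',
    ← mul_finsum' (fun j ↦ u (j - 1)), hshift, finiteTheta]
  · ring
  · exact hfin.preimage (f := fun j : ℤ ↦ j - 1) (sub_left_injective.injOn)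

lemma finiteTheta_eq_prod (α β : R) (m n : ℕ) :
    finiteTheta α β m n =
      (∏ i ∈ range m, (1 + α * (α * β) ^ i)) * ∏ i ∈ range n, (1 + β * (α * β) ^ i) := by
  have h0 : finiteTheta α β 0 0 = 1 := by
    rw [finiteTheta, finsum_eq_single _ (0 : ℤ)]
    · simp [gaussBinomInt, thetaTerm, triangle]
    · intro j hj
      have : -j < 0 ∨ j < 0 := by omega
      simp [gaussBinomInt]
      omega
  induction m with
  | succ m ih => rw [finiteTheta_succ_left, ih, prod_range_succ]; ring
  | zero =>
    induction n with
    | zero => simpa using h0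
    | succ n ih =>
      rw [finiteTheta_comm, finiteTheta_succ_left, finiteTheta_comm, ih, prod_range_succ]
      ring

lemma pow_dvd_prod_add_sub_prod (q : R) (k N : ℕ) :
    q ^ (N + 1) ∣ ∏ i ∈ range (N + k), (1 - q ^ (i + 1)) - ∏ i ∈ range N, (1 - q ^ (i + 1)) := by
  induction k with
  | zero => simp
  | succ k ih =>
    rw [← add_assoc, prod_range_succ]
    have : q ^ (N + 1) ∣ q ^ (N + k + 1) := pow_dvd_pow _ (by omega)
    convert dvd_sub ih (this.mul_left (∏ i ∈ range (N + k), (1 - q ^ (i + 1)))) using 1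
    ring

lemma pow_dvd_prod_shift_sub_one (q : R) (m n : ℕ) :
    q ^ (m + 1) ∣ ∏ i ∈ range n, (1 - q ^ (m + i + 1)) - 1 := by
  induction n with
  | zero => simp
  | succ n ih =>
    rw [prod_range_succ]
    have : q ^ (m + 1) ∣ q ^ (m + n + 1) := pow_dvd_pow _ (by omega)
    convert dvd_sub ih (this.mul_left (∏ i ∈ range n, (1 - q ^ (m + i + 1)))) using 1
    ring

lemma dvd_gaussBinom_mul_prod_sub_one (q : R) {k N : ℕ} (hk : k ≤ N) :
    q ^ (N - k + 1) ∣
      gaussBinom q (N - k) (N + k) * ∏ i ∈ range N, (1 - q ^ (i + 1)) - 1 := by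
  have h1 := pow_dvd_prod_shift_sub_one q (N - k) (N + k)
  rw [← gaussBinom_mul_prod] at h1
  have h2 : q ^ (N - k + 1) ∣ q ^ (N + 1) := pow_dvd_pow _ (by omega)
  convert dvd_sub h1 ((h2.trans (pow_dvd_prod_add_sub_prod q k N)).mul_left
    (gaussBinom q (N - k) (N + k))) using 1
  ring

lemma pow_dvd_thetaTerm (α β : R) (j : ℤ) :
    (α * β) ^ min (triangle j) (triangle (-j)) ∣ thetaTerm α β j := by
  rw [mul_pow]
  exact mul_dvd_mul (pow_dvd_pow _ (min_le_left _ _)) (pow_dvd_pow _ (min_le_right _ _))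

lemma natAbs_le_triangle_add_one (j : ℤ) : j.natAbs ≤ triangle j + 1 := by
  have h := two_mul_triangle j
  have h1 : j ≤ triangle j + 1 := by nlinarith [sq_nonneg (j - 1)]
  have h2 : 0 ≤ (j + 1) * (j + 2) := by
    rcases lt_or_ge j (-1) with hj | hj <;> nlinarith
  have h3 : -j ≤ triangle j + 1 := by nlinarith
  omega

lemma pow_dvd_gaussBinomInt_mul_thetaTerm_sub (α β : R) {N : ℕ} {j : ℤ}
    (hj : j ∈ Icc (-N : ℤ) N) :
    (α * β) ^ N ∣ gaussBinomInt (α * β) (N - j) (N + j) * thetaTerm α β j *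
      ∏ i ∈ range N, (1 - (α * β) ^ (i + 1)) - thetaTerm α β j := by
  rw [mem_Icc] at hj
  have hk : j.natAbs ≤ N := by omega
  have hbin : gaussBinomInt (α * β) (N - j) (N + j) =
      gaussBinom (α * β) (N - j.natAbs) (N + j.natAbs) := by
    rw [← gaussBinomInt_natCast, Nat.cast_sub hk, Nat.cast_add]
    rcases le_total 0 j with h | h
    · rw [Int.natAbs_of_nonneg h]
    · rw [gaussBinomInt_comm, Int.ofNat_natAbs_of_nonpos h, sub_neg_eq_add, ← sub_eq_add_neg]
  have hle : N ≤ N - j.natAbs + 1 + min (triangle j) (triangle (-j)) := by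
    have h1 := natAbs_le_triangle_add_one j
    have h2 := natAbs_le_triangle_add_one (-j)
    rw [Int.natAbs_neg] at h2
    omega
  rw [hbin]
  refine (pow_dvd_pow _ hle).trans ?_
  rw [pow_add]
  convert mul_dvd_mul (dvd_gaussBinom_mul_prod_sub_one (α * β) hk) (pow_dvd_thetaTerm α β j)
    using 1
  ring

theorem pow_dvd_prod_sub_sum_thetaTerm (α β : R) (N : ℕ) :
    (α * β) ^ N ∣
      (∏ i ∈ range N, (1 - (α * β) ^ (i + 1)) * (1 + α * (α * β) ^ i) * (1 + β * (α * β) ^ i)) -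
        ∑ j ∈ Icc (-N : ℤ) N, thetaTerm α β j := by
  have h := finiteTheta_eq_prod α β N N
  rw [finiteTheta, finsum_eq_sum_of_support_subset _ (support_finiteTheta_subset α β N N)] at h
  rw [prod_mul_distrib, prod_mul_distrib, mul_assoc, ← h, mul_comm (∏ i ∈ range N, _), sum_mul,
    ← sum_sub_distrib]
  exact dvd_sum fun j hj ↦ pow_dvd_gaussBinomInt_mul_thetaTerm_sub α β hj

end JacobiTripleProduct

open PowerSeries Filter Topology
open scoped PowerSeries.WithPiTopology

/-- The derivation `X * d / dX` on formal power series. -/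
noncomputable def eulerOp (R : Type*) [CommRing R] : Derivation R R⟦X⟧ R⟦X⟧ :=
  (X : R⟦X⟧) • PowerSeries.derivative R

section

variable {R : Type*} [CommRing R]

lemma coeff_eulerOp (f : R⟦X⟧) (n : ℕ) : coeff n (eulerOp R f) = n * coeff n f := by
  rw [eulerOp, Derivation.smul_apply, smul_eq_mul]
  cases n with
  | zero => simp
  | succ n => rw [coeff_succ_X_mul, coeff_derivative]; push_cast; ring

lemma eulerOp_monomial (n : ℕ) (r : R) :
    eulerOp R (monomial n r) = monomial n (n * r) := by
  ext k
  rw [coeff_eulerOp, coeff_monomial, coeff_monomial]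
  split_ifs with h <;> simp [h]

lemma eulerOp_rescale (f : R⟦X⟧) (r : R) :
    eulerOp R (rescale r f) = rescale r (eulerOp R f) := by
  ext k
  simp only [coeff_eulerOp, coeff_rescale]
  ring

variable [TopologicalSpace R]

lemma tendsto_eulerOp [ContinuousMul R] {ι : Type*} {l : Filter ι} {f : ι → R⟦X⟧} {g : R⟦X⟧}
    (h : Tendsto f l (𝓝 g)) : Tendsto (fun i ↦ eulerOp R (f i)) l (𝓝 (eulerOp R g)) := by
  rw [WithPiTopology.tendsto_iff_coeff_tendsto] at h ⊢
  simp only [coeff_eulerOp]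
  exact fun d ↦ (h d).const_mul _

lemma tendsto_rescale [ContinuousMul R] (r : R) {ι : Type*} {l : Filter ι} {f : ι → R⟦X⟧}
    {g : R⟦X⟧} (h : Tendsto f l (𝓝 g)) :
    Tendsto (fun i ↦ rescale r (f i)) l (𝓝 (rescale r g)) := by
  rw [WithPiTopology.tendsto_iff_coeff_tendsto] at h ⊢
  simp only [coeff_rescale]
  exact fun d ↦ (h d).const_mul _

lemma hasSum_eulerOp [ContinuousMul R] {ι : Type*} {f : ι → R⟦X⟧} {g : R⟦X⟧} (h : HasSum f g) :
    HasSum (fun i ↦ eulerOp R (f i)) (eulerOp R g) := by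
  simpa only [HasSum, map_sum] using tendsto_eulerOp h

lemma hasSum_rescale [ContinuousMul R] (r : R) {ι : Type*} {f : ι → R⟦X⟧} {g : R⟦X⟧}
    (h : HasSum f g) : HasSum (fun i ↦ rescale r (f i)) (rescale r g) := by
  simpa only [HasSum, map_sum] using tendsto_rescale r h

lemma tendsto_zero_of_X_pow_dvd {f : ℕ → R⟦X⟧} (h : ∀ n, X ^ n ∣ f n) :
    Tendsto f atTop (𝓝 0) := by
  rw [WithPiTopology.tendsto_iff_coeff_tendsto]
  intro d
  rw [map_zero]
  exact tendsto_atTop_of_eventually_const (i₀ := d + 1) fun n hn ↦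
    X_pow_dvd_iff.mp (h n) d (by omega)

lemma summable_monomial {ι : Type*} {w : ι → ℕ} (hw : ∀ n, {i | w i ≤ n}.Finite) (c : ι → R) :
    Summable fun i ↦ monomial (w i) (c i) := by
  rw [WithPiTopology.summable_iff_summable_coeff]
  intro d
  refine summable_of_hasFiniteSupport ((hw d).subset fun i hi ↦ ?_)
  rw [Function.mem_support, coeff_monomial] at hi
  by_contra h
  exact hi (if_neg fun h' ↦ h h'.ge)

lemma finite_setOf_add_le {ι κ : Type*} {w : ι → ℕ} {v : κ → ℕ}
    (hw : ∀ n, {i | w i ≤ n}.Finite) (hv : ∀ n, {i | v i ≤ n}.Finite) (n : ℕ) :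
    {p : ι × κ | w p.1 + v p.2 ≤ n}.Finite := by
  refine ((hw n).prod (hv n)).subset fun p hp ↦ ?_
  simp only [Set.mem_ofPred_eq, Set.mem_prod] at hp ⊢
  omega

lemma hasSum_monomial_mul [IsTopologicalRing R] [T2Space R] {ι κ : Type*} {w : ι → ℕ} {v : κ → ℕ}
    (hw : ∀ n, {i | w i ≤ n}.Finite) (hv : ∀ n, {i | v i ≤ n}.Finite) {c : ι → R} {d : κ → R}
    {f g : R⟦X⟧} (hf : HasSum (fun i ↦ monomial (w i) (c i)) f)
    (hg : HasSum (fun i ↦ monomial (v i) (d i)) g) :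
    HasSum (fun p : ι × κ ↦ monomial (w p.1 + v p.2) (c p.1 * d p.2)) (f * g) := by
  have := WithPiTopology.instIsTopologicalRing (R := R)
  have := WithPiTopology.instT2Space (R := R)
  have hsum := summable_monomial (finite_setOf_add_le hw hv) fun p : ι × κ ↦ c p.1 * d p.2
  simp only [← monomial_mul_monomial] at hsum ⊢
  exact HasSum.mul (f := fun i ↦ monomial (w i) (c i)) (g := fun i ↦ monomial (v i) (d i)) hf hg
    hsum

/-- A pair of integers has either equal or opposite parities. -/
def parityEquiv : (ℤ × ℤ) ⊕ (ℤ × ℤ) ≃ ℤ × ℤ where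
  toFun := Sum.elim (fun p ↦ (p.1 + p.2, p.1 - p.2)) (fun p ↦ (p.1 + p.2 + 1, p.1 - p.2))
  invFun p :=
    if (p.1 + p.2) % 2 = 0 then .inl ((p.1 + p.2) / 2, (p.1 - p.2) / 2)
    else .inr ((p.1 + p.2 - 1) / 2, (p.1 - p.2 - 1) / 2)
  left_inv := by
    rintro (⟨r, s⟩ | ⟨r, s⟩)
    · refine (if_pos (by simp only [Sum.elim_inl]; omega)).trans ?_
      simp only [Sum.elim_inl, Sum.inl.injEq, Prod.mk.injEq]
      omega
    · refine (if_neg (by simp only [Sum.elim_inr]; omega)).trans ?_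
      simp only [Sum.elim_inr, Sum.inr.injEq, Prod.mk.injEq]
      omega
  right_inv := by
    rintro ⟨m, n⟩
    dsimp only
    split_ifs with h
    · simp only [Sum.elim_inl, Prod.mk.injEq]
      omega
    · simp only [Sum.elim_inr, Prod.mk.injEq]
      omega

lemma eq_add_of_hasSum_parity [IsTopologicalRing R] [T2Space R] {f : ℤ × ℤ → R⟦X⟧} {g a b : R⟦X⟧}
    (h : HasSum f g) (ha : HasSum (fun p : ℤ × ℤ ↦ f (p.1 + p.2, p.1 - p.2)) a)
    (hb : HasSum (fun p : ℤ × ℤ ↦ f (p.1 + p.2 + 1, p.1 - p.2)) b) : g = a + b := by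
  have := WithPiTopology.instIsTopologicalRing (R := R)
  have := WithPiTopology.instT2Space (R := R)
  refine HasSum.unique ((parityEquiv.hasSum_iff (f := f)).mpr h) (HasSum.sum ?_ ?_)
  · exact ha
  · exact hb

end

lemma tendsto_two_mul_atTop : Tendsto (fun N : ℕ ↦ 2 * N) atTop atTop :=
  tendsto_id.const_mul_atTop' two_pos

section

variable (R : Type*) [CommRing R]

/-- The sign `(-1) ^ j`, for an integer `j`, in a commutative ring. -/
def altSign (j : ℤ) : R := ((j.negOnePow : ℤ) : R)

lemma altSign_add (i j : ℤ) : altSign R (i + j) = altSign R i * altSign R j := by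
  simp [altSign, Int.negOnePow_add]

@[simp]
lemma altSign_neg (j : ℤ) : altSign R (-j) = altSign R j := by
  simp [altSign, Int.negOnePow_neg]

@[simp]
lemma altSign_one : altSign R 1 = -1 := by simp [altSign]

lemma altSign_mul_self (j : ℤ) : altSign R j * altSign R j = 1 := by
  rw [← altSign_add, altSign, Int.negOnePow_even _ ⟨j, rfl⟩]
  simp

lemma altSign_sub (i j : ℤ) : altSign R (i - j) = altSign R i * altSign R j := by
  rw [sub_eq_add_neg, altSign_add, altSign_neg]

lemma neg_one_pow_natAbs (j : ℤ) : (-1 : R) ^ j.natAbs = altSign R j := by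
  rcases Int.even_or_odd j with h | h
  · rw [altSign, Int.negOnePow_even _ h, (Int.natAbs_even.mpr h).neg_one_pow]
    simp
  · rw [altSign, Int.negOnePow_odd _ h, (Int.natAbs_odd.mpr h).neg_one_pow]
    simp

lemma neg_one_pow_natAbs_sq (j : ℤ) : (-1 : R) ^ (j.natAbs ^ 2) = altSign R j := by
  rw [← neg_one_pow_natAbs, sq, pow_mul]
  rcases Nat.even_or_odd j.natAbs with h | h
  · simp [h.neg_one_pow]
  · simp [h.neg_one_pow]

lemma neg_X_pow_eq_monomial (n : ℕ) : (-X : R⟦X⟧) ^ n = monomial n ((-1) ^ n) := by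
  rw [neg_pow, X_pow_eq]
  rcases Nat.even_or_odd n with h | h <;> simp [h.neg_one_pow]

lemma triangle_add_triangle_neg (j : ℤ) : triangle j + triangle (-j) = j.natAbs ^ 2 := by
  have h1 := two_mul_triangle j
  have h2 := two_mul_triangle (-j)
  zify
  rw [sq_abs]
  linarith

lemma finite_setOf_natAbs_sq_le (n : ℕ) : {j : ℤ | j.natAbs ^ 2 ≤ n}.Finite := by
  refine (Set.finite_Icc (-n : ℤ) n).subset fun j hj ↦ ?_
  rw [Set.mem_ofPred_eq] at hj
  have : j.natAbs ≤ j.natAbs ^ 2 := Nat.le_self_pow two_ne_zero _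
  rw [Set.mem_Icc]
  omega

lemma finite_setOf_mul_triangle_le {k : ℕ} (hk : 0 < k) (n : ℕ) :
    {j : ℤ | k * triangle j ≤ n}.Finite := by
  refine (Set.finite_Icc (-(n + 1) : ℤ) (n + 1)).subset fun j hj ↦ ?_
  rw [Set.mem_ofPred_eq] at hj
  have := natAbs_le_triangle_add_one j
  have : triangle j ≤ k * triangle j := Nat.le_mul_of_pos_left _ hk
  rw [Set.mem_Icc]
  omega

/-- The partial products of `∏ (1 - X ^ (k * i))` over `i ≥ 1`. -/
noncomputable def eulerFin (k N : ℕ) : R⟦X⟧ := ∏ i ∈ range N, (1 - X ^ (k * (i + 1)))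

lemma eulerFin_two_mul (k N : ℕ) :
    eulerFin R k (2 * N) =
      (∏ i ∈ range N, (1 - X ^ (k * (2 * i + 1)))) * eulerFin R (2 * k) N := by
  induction N with
  | zero => simp [eulerFin]
  | succ N ih =>
    rw [mul_add, eulerFin, prod_range_succ, prod_range_succ, ← eulerFin, ih, eulerFin, eulerFin,
      prod_range_succ, prod_range_succ, show k * (2 * N + 1 + 1) = 2 * k * (N + 1) by ring]
    ring

lemma rescale_neg_one_X_pow {n : ℕ} (hn : Even n) : rescale (-1) (X ^ n : R⟦X⟧) = X ^ n := by
  rw [map_pow, rescale_neg_one_X, hn.neg_pow]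

lemma rescale_neg_one_eulerFin {k : ℕ} (hk : Even k) (N : ℕ) :
    rescale (-1) (eulerFin R k N) = eulerFin R k N := by
  rw [eulerFin, map_prod]
  refine prod_congr rfl fun i _ ↦ ?_
  rw [map_sub, map_one, rescale_neg_one_X_pow R (hk.mul_right _)]

variable [TopologicalSpace R]

/-- The infinite product `∏ (1 - X ^ (k * i))` over `i ≥ 1`. -/
noncomputable def euler (k : ℕ) : R⟦X⟧ := ∏' i : ℕ, (1 - X ^ (k * (i + 1)))

lemma tendsto_eulerFin {k : ℕ} (hk : 0 < k) :
    Tendsto (eulerFin R k) atTop (𝓝 (euler R k)) := by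
  have h : Multipliable fun i : ℕ ↦ (1 : R⟦X⟧) - X ^ (k * (i + 1)) := by
    simp only [sub_eq_add_neg]
    refine WithPiTopology.multipliable_one_add_of_tendsto_order_atTop_nhds_top R ?_
    nontriviality R using Subsingleton.eq_zero (α := R⟦X⟧)
    refine ENat.tendsto_nhds_top_iff_natCast_lt.mpr fun n ↦ eventually_atTop.mpr ⟨n, ?_⟩
    intro m hm
    rw [order_neg, order_X_pow]
    norm_cast
    nlinarith
  exact h.hasProd.tendsto_prod_nat

lemma constantCoeff_euler [T2Space R] {k : ℕ} (hk : 0 < k) : constantCoeff (euler R k) = 1 := by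
  have h := (WithPiTopology.continuous_constantCoeff R).tendsto _ |>.comp (tendsto_eulerFin R hk)
  refine tendsto_nhds_unique h ?_
  have (N : ℕ) : constantCoeff (eulerFin R k N) = 1 := by
    rw [eulerFin, map_prod]
    exact prod_eq_one fun i _ ↦ by simp [hk.ne']
  simp only [Function.comp_def, this]
  exact tendsto_const_nhds

lemma isUnit_euler [T2Space R] {k : ℕ} (hk : 0 < k) : IsUnit (euler R k) := by
  rw [isUnit_iff_constantCoeff, constantCoeff_euler R hk]
  exact isUnit_one

lemma exists_eulerOp_eq_mul_euler [T2Space R] {k : ℕ} (hk : 0 < k) :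
    ∃ p, eulerOp R (euler R k) = p * euler R k := by
  obtain ⟨c, hc⟩ := (isUnit_euler R hk).dvd (a := eulerOp R (euler R k))
  exact ⟨c, hc.trans (mul_comm _ _)⟩

/-- The theta series `∑ c j * X ^ (j ^ 2)` over the integers. -/
noncomputable def squareSeries (c : ℤ → R) : R⟦X⟧ := ∑' j : ℤ, monomial (j.natAbs ^ 2) (c j)

/-- The theta series `∑ c j * X ^ (k * j * (j + 1) / 2)` over the integers. -/
noncomputable def triangleSeries (k : ℕ) (c : ℤ → R) : R⟦X⟧ :=
  ∑' j : ℤ, monomial (k * triangle j) (c j)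

lemma hasSum_squareSeries (c : ℤ → R) :
    HasSum (fun j : ℤ ↦ monomial (j.natAbs ^ 2) (c j)) (squareSeries R c) :=
  (summable_monomial finite_setOf_natAbs_sq_le c).hasSum

lemma hasSum_triangleSeries {k : ℕ} (hk : 0 < k) (c : ℤ → R) :
    HasSum (fun j : ℤ ↦ monomial (k * triangle j) (c j)) (triangleSeries R k c) :=
  (summable_monomial (finite_setOf_mul_triangle_le hk) c).hasSum

lemma tendsto_prod_thetaTerm [IsTopologicalRing R] {α β f : R⟦X⟧} (hαβ : X ∣ α * β)
    (hf : HasSum (thetaTerm α β) f) :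
    Tendsto (fun N ↦ ∏ i ∈ range N,
      (1 - (α * β) ^ (i + 1)) * (1 + α * (α * β) ^ i) * (1 + β * (α * β) ^ i)) atTop (𝓝 f) := by
  have := WithPiTopology.instIsTopologicalRing (R := R)
  have h := tendsto_zero_of_X_pow_dvd fun N ↦
    (pow_dvd_pow_of_dvd hαβ N).trans (pow_dvd_prod_sub_sum_thetaTerm α β N)
  simpa using h.add (hf.comp tendsto_Icc_neg)

variable [IsTopologicalRing R] [T2Space R]

variable {R} in
lemma mul_eq_of_tendsto {f g h : ℕ → R⟦X⟧} {a b c : R⟦X⟧} (hf : Tendsto f atTop (𝓝 a))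
    (hg : Tendsto g atTop (𝓝 b)) (hh : Tendsto h atTop (𝓝 c)) (e : ∀ n, f n * g n = h n) :
    a * b = c := by
  have := WithPiTopology.instIsTopologicalRing (R := R)
  have := WithPiTopology.instT2Space (R := R)
  exact tendsto_nhds_unique (hf.mul hg) (by simpa only [e] using hh)

theorem squareSeries_altSign_mul_euler :
    squareSeries R (altSign R) * euler R 2 = euler R 1 ^ 2 := by
  have := WithPiTopology.instIsTopologicalRing (R := R)
  have hf : HasSum (thetaTerm (-X : R⟦X⟧) (-X)) (squareSeries R (altSign R)) := by
    convert hasSum_squareSeries R (altSign R) using 2 with j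
    rw [thetaTerm, ← pow_add, triangle_add_triangle_neg, neg_X_pow_eq_monomial,
      neg_one_pow_natAbs_sq]
  refine mul_eq_of_tendsto (tendsto_prod_thetaTerm R (by simp) hf)
    (tendsto_eulerFin R two_pos)
    (((tendsto_eulerFin R one_pos).comp tendsto_two_mul_atTop).pow 2) fun N ↦ ?_
  simp only [Function.comp_apply]
  rw [eulerFin_two_mul, prod_mul_distrib, prod_mul_distrib, mul_pow, mul_one]
  have h1 : ∏ i ∈ range N, (1 - (-X * -X : R⟦X⟧) ^ (i + 1)) = eulerFin R 2 N := by
    rw [neg_mul_neg, ← sq]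
    simp only [← pow_mul, eulerFin]
  have h2 : ∏ i ∈ range N, (1 + -X * (-X * -X : R⟦X⟧) ^ i) =
      ∏ i ∈ range N, (1 - X ^ (1 * (2 * i + 1))) :=
    prod_congr rfl fun i _ ↦ by ring
  rw [h1, h2]
  ring

theorem triangleSeries_one_mul_euler :
    triangleSeries R 2 (fun _ ↦ 1) * euler R 2 = 2 * euler R 4 ^ 2 := by
  have := WithPiTopology.instIsTopologicalRing (R := R)
  have hf : HasSum (thetaTerm (X ^ 2 : R⟦X⟧) 1) (triangleSeries R 2 (fun _ ↦ 1)) := by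
    convert hasSum_triangleSeries R two_pos (fun _ ↦ (1 : R)) using 2 with j
    rw [thetaTerm, one_pow, mul_one, ← pow_mul, X_pow_eq]
  have h4 := tendsto_eulerFin R (k := 4) (by norm_num)
  rw [sq, ← mul_assoc]
  refine mul_eq_of_tendsto
    ((tendsto_add_atTop_iff_nat 1).mpr (tendsto_prod_thetaTerm R ⟨X, by ring⟩ hf))
    (tendsto_eulerFin R two_pos)
    ((h4.const_mul 2).mul ((tendsto_add_atTop_iff_nat 1).mpr h4)) fun N ↦ ?_
  simp only [mul_one, one_mul]
  have h1 : ∏ i ∈ range (N + 1), (1 - (X ^ 2 : R⟦X⟧) ^ (i + 1)) * (1 + X ^ 2 * (X ^ 2) ^ i) =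
      eulerFin R 4 (N + 1) :=
    prod_congr rfl fun i _ ↦ by ring
  have h2 : (∏ i ∈ range N, (1 + (X ^ 2 : R⟦X⟧) ^ (i + 1))) * eulerFin R 2 N = eulerFin R 4 N := by
    rw [eulerFin, ← prod_mul_distrib]
    exact prod_congr rfl fun i _ ↦ by ring
  rw [prod_mul_distrib, h1, prod_range_succ' (fun i ↦ 1 + (X ^ 2 : R⟦X⟧) ^ i), ← h2]
  ring

lemma rescale_neg_one_euler {k : ℕ} (hk : 0 < k) (hk' : Even k) :
    rescale (-1) (euler R k) = euler R k := by
  have := WithPiTopology.instT2Space (R := R)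
  refine tendsto_nhds_unique (tendsto_rescale (-1) (tendsto_eulerFin R hk)) ?_
  simpa only [rescale_neg_one_eulerFin R hk'] using tendsto_eulerFin R hk

theorem euler_one_mul_rescale_mul_euler_four :
    euler R 1 * rescale (-1) (euler R 1) * euler R 4 = euler R 2 ^ 3 := by
  have := WithPiTopology.instIsTopologicalRing (R := R)
  have h1 := (tendsto_eulerFin R one_pos).comp tendsto_two_mul_atTop
  have h2 := tendsto_eulerFin R two_pos
  rw [pow_succ' (euler R 2) 2]
  refine mul_eq_of_tendsto (h1.mul (tendsto_rescale (-1) h1)) (tendsto_eulerFin R (by norm_num))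
    (((h2.comp tendsto_two_mul_atTop).mul (h2.pow 2)).congr fun N ↦ ?_) fun N ↦ rfl
  simp only [Function.comp_apply]
  rw [eulerFin_two_mul, eulerFin_two_mul, map_mul, mul_one, rescale_neg_one_eulerFin R even_two,
    map_prod]
  have h : ∏ i ∈ range N, (1 - X ^ (2 * (2 * i + 1)) : R⟦X⟧) =
      (∏ i ∈ range N, (1 - X ^ (1 * (2 * i + 1)))) *
        ∏ i ∈ range N, rescale (-1) (1 - X ^ (1 * (2 * i + 1))) := by
    rw [← prod_mul_distrib]
    refine prod_congr rfl fun i _ ↦ ?_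
    rw [map_sub, map_one, map_pow, rescale_neg_one_X, one_mul, Odd.neg_pow ⟨i, rfl⟩]
    ring
  rw [h]
  ring_nf

lemma rescale_squareSeries (c : ℤ → R) :
    rescale (-1) (squareSeries R c) = squareSeries R fun j ↦ altSign R j * c j := by
  have := WithPiTopology.instT2Space (R := R)
  refine (hasSum_rescale (-1) (hasSum_squareSeries R c)).unique ?_
  convert hasSum_squareSeries R fun j ↦ altSign R j * c j using 2 with j
  rw [← neg_one_pow_natAbs_sq]
  ext n
  rw [coeff_rescale, coeff_monomial, coeff_monomial]
  split_ifs with h <;> simp [h]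

theorem squareSeries_one_mul_euler :
    squareSeries R (fun _ ↦ 1) * euler R 1 ^ 2 * euler R 4 ^ 2 = euler R 2 ^ 5 := by
  have h := congrArg (rescale (-1)) (squareSeries_altSign_mul_euler R)
  rw [map_mul, map_pow, rescale_squareSeries, rescale_neg_one_euler R two_pos even_two] at h
  simp only [altSign_mul_self] at h
  refine (isUnit_euler R two_pos).mul_right_cancel ?_
  have h' := euler_one_mul_rescale_mul_euler_four R
  linear_combination euler R 1 ^ 2 * euler R 4 ^ 2 * h +
    (euler R 1 * rescale (-1) (euler R 1) * euler R 4 + euler R 2 ^ 3) * h'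

end

section Jacobi

variable {R : Type*} [CommRing R]

lemma snd_pow_of_snd_eq_mul_fst {x : DualNumber R} {c : R} (h : x.snd = c * x.fst) (n : ℕ) :
    (x ^ n).snd = n * c * (x ^ n).fst := by
  induction n with
  | zero => simp
  | succ n ih =>
    rw [pow_succ, TrivSqZeroExt.snd_mul, TrivSqZeroExt.fst_mul, ih, h]
    simp only [smul_eq_mul, MulOpposite.smul_eq_mul_unop, MulOpposite.unop_op]
    push_cast
    ring

lemma dvd_snd_of_inl_dvd {x : R} {y : DualNumber R} (h : TrivSqZeroExt.inl x ∣ y) :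
    x ∣ y.snd := by
  obtain ⟨z, rfl⟩ := h
  simp

variable {k : ℕ} {α β : DualNumber R⟦X⟧}

lemma snd_thetaTerm (hα : α.fst = -X ^ k) (hα' : α.snd = -X ^ k) (hβ : β.fst = -1)
    (hβ' : β.snd = 1) (j : ℤ) :
    (thetaTerm α β j).snd = monomial (k * triangle j) (j * altSign R j) := by
  have h1 := snd_pow_of_snd_eq_mul_fst (x := α) (c := 1) (by rw [hα, hα', one_mul]) (triangle j)
  have h2 := snd_pow_of_snd_eq_mul_fst (x := β) (c := -1) (by rw [hβ, hβ']; ring) (triangle (-j))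
  have h3 : ((triangle j : ℤ) : R⟦X⟧) - (triangle (-j) : ℤ) = (j : ℤ) := by
    rw [← Int.cast_sub]
    congr 1
    linarith [two_mul_triangle j, two_mul_triangle (-j)]
  have h4 : (monomial (k * triangle j) (j * altSign R j) : R⟦X⟧) =
      (j : R⟦X⟧) * ((-X ^ k) ^ triangle j * (-1) ^ triangle (-j)) := by
    rw [neg_pow, mul_right_comm, ← pow_add, triangle_add_triangle_neg, ← pow_mul,
      ← neg_one_pow_natAbs_sq, X_pow_eq, ← map_intCast (C (R := R)), ← map_one (C (R := R)),
      ← map_neg, ← map_pow, ← mul_assoc, ← map_mul, ← monomial_zero_eq_C_apply,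
      monomial_mul_monomial, zero_add, mul_one]
  rw [thetaTerm, TrivSqZeroExt.snd_mul, h1, h2, TrivSqZeroExt.fst_pow, TrivSqZeroExt.fst_pow,
    hα, hβ, h4, ← h3]
  simp only [smul_eq_mul, MulOpposite.smul_eq_mul_unop, MulOpposite.unop_op]
  push_cast
  ring

lemma snd_prod_thetaTerm (hα : α.fst = -X ^ k) (hβ : β.fst = -1) (hβ' : β.snd = 1)
    (N : ℕ) :
    (∏ i ∈ range (N + 1), (1 - (α * β) ^ (i + 1)) * (1 + α * (α * β) ^ i) *
      (1 + β * (α * β) ^ i)).snd = eulerFin R k (N + 1) ^ 2 * eulerFin R k N := by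
  have hQ : (α * β).fst = X ^ k := by rw [TrivSqZeroExt.fst_mul, hα, hβ]; ring
  have h1 : 1 + β = DualNumber.eps := by ext1 <;> simp [hβ, hβ']
  have hsnd (x : DualNumber R⟦X⟧) : (x * DualNumber.eps).snd = x.fst := by simp
  have hfst (x : DualNumber R⟦X⟧) : x.fst = TrivSqZeroExt.fstHom R⟦X⟧ R⟦X⟧ R⟦X⟧ x := rfl
  rw [prod_mul_distrib, prod_mul_distrib, prod_range_succ' (fun i ↦ 1 + β * _ ^ i),
    pow_zero, mul_one, h1, ← mul_assoc, hsnd]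
  rw [hfst] at hα hβ hQ ⊢
  simp only [map_mul, map_prod, map_sub, map_add, map_one, map_pow] at hQ ⊢
  rw [hQ, hα, hβ, sq]
  refine congrArg₂ _ (congrArg₂ _ ?_ ?_) ?_ <;> rw [eulerFin] <;>
    exact prod_congr rfl fun i _ ↦ by ring

end Jacobi

section

variable (R : Type*) [CommRing R] [TopologicalSpace R] [IsTopologicalRing R] [T2Space R]

lemma triangleSeries_intCast_mul_altSign {k : ℕ} (hk : 0 < k) :
    triangleSeries R k (fun j ↦ j * altSign R j) = euler R k ^ 3 := by
  have := WithPiTopology.instIsTopologicalRing (R := R)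
  have := WithPiTopology.instT2Space (R := R)
  set α : DualNumber R⟦X⟧ := TrivSqZeroExt.inl (-X ^ k) + TrivSqZeroExt.inr (-X ^ k) with hα
  set β : DualNumber R⟦X⟧ := TrivSqZeroExt.inl (-1) + TrivSqZeroExt.inr 1 with hβ
  have hα1 : α.fst = -X ^ k := by simp [hα]
  have hα2 : α.snd = -X ^ k := by simp [hα]
  have hβ1 : β.fst = -1 := by simp [hβ]
  have hβ2 : β.snd = 1 := by simp [hβ]
  have hQ : α * β = TrivSqZeroExt.inl (X ^ k) := by
    ext1
    · simp [hα1, hβ1]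
    · simp [hα1, hα2, hβ1, hβ2]
  have hdvd (N : ℕ) : X ^ N ∣ eulerFin R k (N + 1) ^ 2 * eulerFin R k N -
      ∑ j ∈ Icc (-(N + 1 : ℕ) : ℤ) (N + 1 : ℕ),
        monomial (k * triangle j) ((j : R) * altSign R j) := by
    have h := pow_dvd_prod_sub_sum_thetaTerm α β (N + 1)
    nth_rw 1 [hQ] at h
    rw [TrivSqZeroExt.inl_pow (X ^ k : R⟦X⟧)] at h
    have h' := dvd_snd_of_inl_dvd h
    rw [TrivSqZeroExt.snd_sub, snd_prod_thetaTerm hα1 hβ1 hβ2, TrivSqZeroExt.snd_sum] at h'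
    simp only [snd_thetaTerm hα1 hα2 hβ1 hβ2] at h'
    rw [← pow_mul] at h'
    exact (pow_dvd_pow X (by nlinarith)).trans h'
  have hlim := tendsto_eulerFin R hk
  have hsum := (tendsto_add_atTop_iff_nat 1).mpr
    ((hasSum_triangleSeries R hk fun j ↦ j * altSign R j).comp tendsto_Icc_neg)
  have h := tendsto_nhds_unique
    (((((tendsto_add_atTop_iff_nat 1).mpr hlim).pow 2).mul hlim).sub hsum)
    (tendsto_zero_of_X_pow_dvd hdvd)
  linear_combination -h

/-- Jacobi's identity for the cube of the Euler product, summed over all integers. -/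
theorem triangleSeries_altSign_mul_two_mul_add_one {k : ℕ} (hk : 0 < k) :
    triangleSeries R k (fun j ↦ altSign R j * (2 * j + 1)) = 2 * euler R k ^ 3 := by
  have := WithPiTopology.instIsTopologicalRing (R := R)
  have := WithPiTopology.instT2Space (R := R)
  have h := hasSum_triangleSeries R hk fun j ↦ j * altSign R j
  rw [triangleSeries_intCast_mul_altSign R hk] at h
  have h' := ((Equiv.subLeft (-1 : ℤ)).hasSum_iff).mpr h
  rw [two_mul]
  refine (hasSum_triangleSeries R hk _).unique ?_
  convert h.add h' using 2 with j
  have ht : triangle (-1 - j) = triangle j := by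
    have h1 := two_mul_triangle j
    have h2 := two_mul_triangle (-1 - j)
    zify
    linarith
  simp only [Function.comp_apply, Equiv.subLeft_apply]
  rw [ht, ← map_add, altSign_sub, altSign_neg, altSign_one]
  push_cast
  congr 1
  ring

end

lemma hasSum_congr {ι M : Type*} [AddCommMonoid M] [TopologicalSpace M] {f g : ι → M} {a : M}
    (h : ∀ i, f i = g i) : HasSum f a ↔ HasSum g a := by
  rw [funext h]

lemma finite_setOf_comp_le {ι κ : Type*} {w : ι → ℕ} (hw : ∀ n, {i | w i ≤ n}.Finite)
    {e : κ → ι} (he : Function.Injective e) (n : ℕ) : {k | w (e k) ≤ n}.Finite :=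
  (hw n).preimage he.injOn

section

variable (R : Type*) [CommRing R]

lemma cast_natAbs_sq (j : ℤ) : ((j.natAbs ^ 2 : ℕ) : R) = (j : R) ^ 2 := by
  rw [← Int.cast_natCast]
  push_cast
  rw [← Int.cast_pow, sq_abs, Int.cast_pow]

lemma cast_four_mul_two_mul_triangle_add_one (j : ℤ) :
    (4 * (2 * triangle j : ℕ) + 1 : R) = (2 * j + 1) ^ 2 := by
  have h := congrArg (Int.cast (R := R)) (two_mul_triangle j)
  push_cast at h ⊢
  linear_combination 4 * h

lemma two_ne_zero_powerSeries (h2 : (2 : R) ≠ 0) : (2 : R⟦X⟧) ≠ 0 := by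
  rw [← map_ofNat (C (R := R))]
  exact fun h ↦ h2 (C_injective (h.trans (map_zero C).symm))

lemma four_mul_monomial (n : ℕ) (r : R) : 4 * monomial n r = monomial n (4 * r) := by
  rw [← map_ofNat (C (R := R)), ← monomial_zero_eq_C_apply, monomial_mul_monomial, zero_add]

variable [TopologicalSpace R] [IsTopologicalRing R]

lemma hasSum_eulerOp_squareSeries (c : ℤ → R) :
    HasSum (fun j : ℤ ↦ monomial (j.natAbs ^ 2) ((j : R) ^ 2 * c j))
      (eulerOp R (squareSeries R c)) := by
  simpa only [eulerOp_monomial, cast_natAbs_sq] using hasSum_eulerOp (hasSum_squareSeries R c)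

lemma hasSum_eulerOp_triangleSeries_two :
    HasSum (fun j : ℤ ↦ monomial (2 * triangle j) ((2 * j + 1 : R) ^ 2))
      (4 * eulerOp R (triangleSeries R 2 fun _ ↦ 1) + triangleSeries R 2 fun _ ↦ 1) := by
  have := WithPiTopology.instIsTopologicalRing (R := R)
  have h := hasSum_triangleSeries R two_pos fun _ ↦ (1 : R)
  refine (hasSum_congr fun j ↦ ?_).mpr (((hasSum_eulerOp h).mul_left 4).add h)
  rw [eulerOp_monomial, ← cast_four_mul_two_mul_triangle_add_one, four_mul_monomial, ← map_add,
    mul_one]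

variable [T2Space R] [IsDomain R]

variable {R} in
lemma hasSum_zero_of_neg (h2 : (2 : R) ≠ 0) {ι : Type*} {f : ι → R⟦X⟧} (hf : Summable f)
    (e : ι ≃ ι) (he : ∀ i, f (e i) = -f i) : HasSum f 0 := by
  have := WithPiTopology.instIsTopologicalRing (R := R)
  have := WithPiTopology.instT2Space (R := R)
  obtain ⟨a, ha⟩ := hf
  have h := (hasSum_congr he).mp (e.hasSum_iff.mpr ha)
  have h' := ha.unique (by simpa using h.neg)
  have hdouble : 2 * a = 0 := by linear_combination h'
  rwa [(mul_eq_zero.mp hdouble).resolve_left (two_ne_zero_powerSeries R h2)] at ha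

theorem squareSeries_wronskian (h2 : (2 : R) ≠ 0) :
    squareSeries R (altSign R) * eulerOp R (squareSeries R fun _ ↦ 1) -
        squareSeries R (fun _ ↦ 1) * eulerOp R (squareSeries R (altSign R)) =
      4 * X * euler R 4 ^ 6 := by
  have := WithPiTopology.instIsTopologicalRing (R := R)
  have := WithPiTopology.instT2Space (R := R)
  have hfib := finite_setOf_natAbs_sq_le
  have hT := finite_setOf_mul_triangle_le (k := 4) (by norm_num)
  have h := (hasSum_monomial_mul hfib hfib (hasSum_squareSeries R (altSign R))
    (hasSum_eulerOp_squareSeries R fun _ ↦ 1)).sub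
    (hasSum_monomial_mul hfib hfib (hasSum_eulerOp_squareSeries R (altSign R))
      (hasSum_squareSeries R fun _ ↦ 1))
  simp only [← map_sub, mul_one] at h
  rw [mul_comm (eulerOp R (squareSeries R (altSign R)))] at h
  have heven : HasSum (fun p : ℤ × ℤ ↦
      monomial ((p.1 + p.2).natAbs ^ 2 + (p.1 - p.2).natAbs ^ 2)
        (altSign R (p.1 + p.2) * ((p.1 - p.2 : ℤ) : R) ^ 2 -
          ((p.1 + p.2 : ℤ) : R) ^ 2 * altSign R (p.1 + p.2))) 0 := by
    refine hasSum_zero_of_neg h2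
      (summable_monomial (finite_setOf_comp_le (finite_setOf_add_le hfib hfib)
        (parityEquiv.injective.comp Sum.inl_injective)) _)
      (Equiv.prodCongr (Equiv.refl ℤ) (Equiv.neg ℤ)) fun p ↦ ?_
    simp only [Equiv.prodCongr_apply, Prod.map_fst, Prod.map_snd, Equiv.refl_apply, Equiv.neg_apply]
    rw [sub_neg_eq_add, ← sub_eq_add_neg, ← map_neg, add_comm (_ ^ 2), altSign_sub, altSign_add]
    congr 1
    ring
  have hJ := hasSum_triangleSeries R (k := 4) (by norm_num) fun j ↦ altSign R j * (2 * j + 1)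
  rw [triangleSeries_altSign_mul_two_mul_add_one R (by norm_num)] at hJ
  have hodd : HasSum (fun p : ℤ × ℤ ↦
      monomial ((p.1 + p.2 + 1).natAbs ^ 2 + (p.1 - p.2).natAbs ^ 2)
        (altSign R (p.1 + p.2 + 1) * ((p.1 - p.2 : ℤ) : R) ^ 2 -
          ((p.1 + p.2 + 1 : ℤ) : R) ^ 2 * altSign R (p.1 + p.2 + 1)))
      (X * (2 * euler R 4 ^ 3 * (2 * euler R 4 ^ 3))) := by
    refine (hasSum_congr fun p ↦ ?_).mpr ((hasSum_monomial_mul hT hT hJ hJ).mul_left X)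
    have hw : (p.1 + p.2 + 1).natAbs ^ 2 + (p.1 - p.2).natAbs ^ 2 =
        1 + (4 * triangle p.1 + 4 * triangle p.2) := by
      zify
      rw [sq_abs, sq_abs]
      linear_combination -2 * two_mul_triangle p.1 - 2 * two_mul_triangle p.2
    rw [hw, X_eq, monomial_mul_monomial, one_mul, altSign_add, altSign_add, altSign_one]
    congr 1
    push_cast
    ring
  rw [eq_add_of_hasSum_parity h heven hodd]
  ring

theorem squareSeries_triangleSeries_wronskian (h2 : (2 : R) ≠ 0) :
    squareSeries R (fun _ ↦ 1) * (4 * eulerOp R (triangleSeries R 2 fun _ ↦ 1) +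
        triangleSeries R 2 fun _ ↦ 1) -
      4 * triangleSeries R 2 (fun _ ↦ 1) * eulerOp R (squareSeries R fun _ ↦ 1) =
        2 * euler R 1 ^ 6 := by
  have := WithPiTopology.instIsTopologicalRing (R := R)
  have := WithPiTopology.instT2Space (R := R)
  have hfib := finite_setOf_natAbs_sq_le
  have hT1 := finite_setOf_mul_triangle_le one_pos
  have hT2 := finite_setOf_mul_triangle_le two_pos
  have hJ := hasSum_triangleSeries R one_pos fun j ↦ altSign R j * (2 * j + 1)
  rw [triangleSeries_altSign_mul_two_mul_add_one R one_pos] at hJ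
  have h := hasSum_monomial_mul hT1 hT1 hJ hJ
  have hu := (hasSum_monomial_mul hT2 hfib (hasSum_eulerOp_triangleSeries_two R)
    (hasSum_squareSeries R fun _ ↦ 1)).sub
    ((hasSum_monomial_mul hT2 hfib (hasSum_triangleSeries R two_pos fun _ ↦ 1)
      (hasSum_eulerOp_squareSeries R fun _ ↦ 1)).mul_left 4)
  simp only [four_mul_monomial, ← map_sub, mul_one, one_mul] at hu
  refine mul_left_cancel₀ (two_ne_zero_powerSeries R h2) ?_
  have key := eq_add_of_hasSum_parity h
    ((hasSum_congr (g := fun p ↦ _) fun p ↦ ?_).mp hu)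
    ((hasSum_congr (g := fun p ↦ _) fun p ↦ ?_).mp
      (((Equiv.prodComm ℤ ℤ).trans
        (Equiv.prodCongr (Equiv.refl ℤ) (Equiv.addRight 1))).hasSum_iff.mpr hu))
  · linear_combination -key
  · have hw : 2 * triangle p.1 + p.2.natAbs ^ 2 =
        1 * triangle (p.1 + p.2) + 1 * triangle (p.1 - p.2) := by
      have h1 := two_mul_triangle p.1
      have h2 := two_mul_triangle (p.1 + p.2)
      have h3 := two_mul_triangle (p.1 - p.2)
      zify
      rw [sq_abs]
      linarith
    have hs := altSign_mul_self R
    rw [hw]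
    dsimp only
    rw [altSign_add, altSign_sub]
    congr 1
    push_cast
    linear_combination -(((2 * p.1 + 1 : R) ^ 2 - 4 * p.2 ^ 2) * altSign R p.2 * altSign R p.2 *
      hs p.1) - ((2 * p.1 + 1 : R) ^ 2 - 4 * p.2 ^ 2) * hs p.2
  · have hw : 2 * triangle p.2 + (p.1 + 1).natAbs ^ 2 =
        1 * triangle (p.1 + p.2 + 1) + 1 * triangle (p.1 - p.2) := by
      have h1 := two_mul_triangle p.2
      have h2 := two_mul_triangle (p.1 + p.2 + 1)
      have h3 := two_mul_triangle (p.1 - p.2)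
      zify
      rw [sq_abs]
      linarith
    have hs := altSign_mul_self R
    simp only [Function.comp_apply, Equiv.trans_apply, Equiv.prodComm_apply, Prod.swap,
      Equiv.prodCongr_apply, Prod.map_apply, Equiv.refl_apply, Equiv.coe_addRight]
    rw [hw, altSign_add, altSign_add, altSign_sub, altSign_one]
    congr 1
    push_cast
    linear_combination -(((2 * p.2 + 1 : R) ^ 2 - 4 * (p.1 + 1) ^ 2) * altSign R p.2 *
      altSign R p.2 * hs p.1) - ((2 * p.2 + 1 : R) ^ 2 - 4 * (p.1 + 1) ^ 2) * hs p.2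

end

section

variable {R A : Type*} [CommRing R] [CommRing A] [Algebra R A] (D : Derivation R A A)

lemma derivation_pow_of_eq_mul {f p : A} (h : D f = p * f) (n : ℕ) :
    D (f ^ n) = n * p * f ^ n := by
  rcases n with _ | n
  · simp
  · rw [D.leibniz_pow, h]
    simp only [smul_eq_mul, nsmul_eq_mul, Nat.add_sub_cancel]
    ring

/-- The quadratic relation between the logarithmic derivatives of the Euler products of levels
one and two that follows from the two theta function Wronskians. -/
lemma sq_logDeriv_of_wronskian [IsDomain A] (h2 : (2 : A) ≠ 0) {q e₁ e₂ e₄ s a b t p₁ p₂ p₄ : A}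
    (he₁ : e₁ ≠ 0) (he₂ : e₂ ≠ 0) (he₄ : e₄ ≠ 0) (hD₁ : D e₁ = p₁ * e₁) (hD₂ : D e₂ = p₂ * e₂)
    (hD₄ : D e₄ = p₄ * e₄) (hb : b * e₂ = e₁ ^ 2) (ht : t * e₂ = 2 * e₄ ^ 2)
    (ha : a * e₁ ^ 2 * e₄ ^ 2 = e₂ ^ 5) (hs : e₁ * s * e₄ = e₂ ^ 3)
    (hab : b * D a - a * D b = 4 * q * e₄ ^ 6)
    (hat : a * (4 * D t + t) - 4 * t * D a = 2 * e₁ ^ 6)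
    (hbt : b * (4 * D t + t) - 4 * t * D b = 2 * s ^ 6) :
    e₁ ^ 8 * e₂ ^ 8 * (1 + 24 * p₂ - 24 * p₁) ^ 2 = e₁ ^ 24 + 64 * q * e₂ ^ 24 := by
  have h1 := derivation_pow_of_eq_mul D hD₁ 2
  have h4 := derivation_pow_of_eq_mul D hD₄ 2
  have h5 := derivation_pow_of_eq_mul D hD₂ 5
  have hDb : D b = (2 * p₁ - p₂) * b := by
    have h := congrArg D hb
    rw [D.leibniz, h1, hD₂] at h
    simp only [smul_eq_mul] at h
    push_cast at h
    refine mul_left_cancel₀ he₂ ?_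
    linear_combination h - 2 * p₁ * hb
  have hDt : D t = (2 * p₄ - p₂) * t := by
    have h := congrArg D ht
    rw [D.leibniz, D.leibniz, h4, hD₂, ← Nat.cast_ofNat, D.map_natCast] at h
    simp only [smul_eq_mul] at h
    push_cast at h
    refine mul_left_cancel₀ he₂ ?_
    linear_combination h - 2 * p₄ * ht
  have hDa : D a = (5 * p₂ - 2 * p₁ - 2 * p₄) * a := by
    have h := congrArg D ha
    rw [D.leibniz, D.leibniz, h1, h4, h5] at h
    simp only [smul_eq_mul] at h
    push_cast at h
    refine mul_left_cancel₀ (pow_ne_zero 2 (mul_ne_zero he₁ he₄)) ?_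
    linear_combination h - 5 * p₂ * ha
  rw [hDa, hDb] at hab
  rw [hDa, hDt] at hat
  rw [hDb, hDt] at hbt
  have hab' : e₂ ^ 4 * (3 * p₂ - 2 * p₁ - p₄) = 2 * q * e₄ ^ 8 := by
    have hm : a * b * e₄ ^ 2 = e₂ ^ 4 := by
      refine mul_left_cancel₀ (mul_ne_zero (pow_ne_zero 2 he₁) he₂) ?_
      linear_combination a * e₁ ^ 2 * e₄ ^ 2 * hb + e₁ ^ 2 * ha
    refine mul_left_cancel₀ h2 ?_
    linear_combination e₄ ^ 2 * hab - (6 * p₂ - 4 * p₁ - 2 * p₄) * hm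
  have hat' : e₂ ^ 4 * (16 * p₄ - 24 * p₂ + 8 * p₁ + 1) = e₁ ^ 8 := by
    refine mul_left_cancel₀ (mul_ne_zero h2 (mul_ne_zero he₂ (pow_ne_zero 2 he₄))) ?_
    linear_combination e₁ ^ 2 * e₂ * e₄ ^ 2 * hat - (16 * p₄ - 24 * p₂ + 8 * p₁ + 1) *
      (a * e₁ ^ 2 * e₄ ^ 2 * ht + 2 * e₄ ^ 2 * ha)
  have hbt' : e₁ ^ 8 * e₄ ^ 8 * (8 * p₄ - 8 * p₁ + 1) = e₂ ^ 20 := by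
    have hs6 := congrArg (· ^ 6) hs
    refine mul_left_cancel₀ h2 ?_
    linear_combination e₁ ^ 6 * e₄ ^ 6 * e₂ ^ 2 * hbt - e₁ ^ 6 * e₄ ^ 6 * (8 * p₄ - 8 * p₁ + 1) *
      (b * e₂ * ht + 2 * e₄ ^ 2 * hb) + 2 * e₂ ^ 2 * hs6
  have hz : q * e₂ ^ 24 = e₁ ^ 8 * (q * e₄ ^ 8) * (16 * (q * e₄ ^ 8) + e₁ ^ 8) := by
    linear_combination -q * e₂ ^ 4 * hbt' + q * e₁ ^ 8 * e₄ ^ 8 * (8 * hab' + hat')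
  have hε : e₂ ^ 4 * (1 + 24 * p₂ - 24 * p₁) = 32 * (q * e₄ ^ 8) + e₁ ^ 8 := by
    linear_combination 16 * hab' + hat'
  have hε2 := congrArg (· ^ 2) hε
  linear_combination e₁ ^ 8 * hε2 - 64 * hz

end

section

variable (R : Type*) [CommRing R] [TopologicalSpace R] [IsTopologicalRing R] [T2Space R]

lemma rescale_triangleSeries_two_one :
    rescale (-1) (triangleSeries R 2 fun _ ↦ 1) = triangleSeries R 2 fun _ ↦ 1 := by
  have h := congrArg (rescale (-1)) (triangleSeries_one_mul_euler R)
  have h4 := rescale_neg_one_euler R (k := 4) (by norm_num) (by decide)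
  rw [map_mul, map_mul, map_pow, map_ofNat, h4, rescale_neg_one_euler R two_pos even_two,
    ← triangleSeries_one_mul_euler] at h
  exact (isUnit_euler R two_pos).mul_right_cancel h

lemma squareSeries_altSign_triangleSeries_wronskian [IsDomain R] (h2 : (2 : R) ≠ 0) :
    squareSeries R (altSign R) * (4 * eulerOp R (triangleSeries R 2 fun _ ↦ 1) +
        triangleSeries R 2 fun _ ↦ 1) -
      4 * triangleSeries R 2 (fun _ ↦ 1) * eulerOp R (squareSeries R (altSign R)) =
        2 * rescale (-1) (euler R 1) ^ 6 := by
  have h := congrArg (rescale (-1)) (squareSeries_triangleSeries_wronskian R h2)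
  simpa only [map_sub, map_mul, map_add, map_pow, map_ofNat, ← eulerOp_rescale,
    rescale_triangleSeries_two_one, rescale_squareSeries, mul_one] using h

theorem sq_logDeriv_euler [IsDomain R] (h2 : (2 : R) ≠ 0) {p₁ p₂ : R⟦X⟧}
    (h₁ : eulerOp R (euler R 1) = p₁ * euler R 1) (h₂ : eulerOp R (euler R 2) = p₂ * euler R 2) :
    euler R 1 ^ 8 * euler R 2 ^ 8 * (1 + 24 * p₂ - 24 * p₁) ^ 2 =
      euler R 1 ^ 24 + 64 * X * euler R 2 ^ 24 := by
  have h4 : 0 < 4 := by norm_num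
  obtain ⟨p₄, h₄⟩ := exists_eulerOp_eq_mul_euler R h4
  exact sq_logDeriv_of_wronskian (eulerOp R) (two_ne_zero_powerSeries R h2)
    (isUnit_euler R one_pos).ne_zero (isUnit_euler R two_pos).ne_zero (isUnit_euler R h4).ne_zero
    h₁ h₂ h₄ (squareSeries_altSign_mul_euler R) (triangleSeries_one_mul_euler R)
    (squareSeries_one_mul_euler R) (euler_one_mul_rescale_mul_euler_four R)
    (squareSeries_wronskian R h2) (squareSeries_triangleSeries_wronskian R h2)
    (squareSeries_altSign_triangleSeries_wronskian R h2)

end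

section

variable {R A : Type*} [CommRing R] [CommRing A] [Algebra R A] (D : Derivation R A A)

/-- The differential equation for `P = k + 3 * p`, where `p` is the logarithmic derivative of `e`,
equivalent to `(D + k) ^ 3` fixing `e ^ 3` up to the factor `k ^ 3`. -/
lemma chazy_of_cube [IsDomain A] {e p f : A} (k : A) (hk : D k = 0) (he : e ≠ 0)
    (hp : D e = p * e) (hf : f = k + 3 * p)
    (h : D (D (D (e ^ 3))) + 3 * k * D (D (e ^ 3)) + 3 * k ^ 2 * D (e ^ 3) = 0) :
    D (D f) + 3 * f * D f + f ^ 3 = k ^ 3 := by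
  have h3 : D 3 = 0 := by rw [← Nat.cast_ofNat, D.map_natCast]
  have hDf : D f = 3 * D p := by simp [hf, hk, h3]
  have hDDf : D (D f) = 3 * D (D p) := by simp [hDf, h3]
  have e1 : D (e ^ 3) = 3 * p * e ^ 3 := by
    simpa using derivation_pow_of_eq_mul D hp 3
  have e2 : D (D (e ^ 3)) = (3 * D p + 9 * p ^ 2) * e ^ 3 := by
    rw [e1, D.leibniz, D.leibniz, e1, h3]
    simp only [smul_eq_mul]
    ring
  have e3 : D (D (D (e ^ 3))) = (3 * D (D p) + 27 * p * D p + 27 * p ^ 3) * e ^ 3 := by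
    have h9 : D 9 = 0 := by rw [← Nat.cast_ofNat, D.map_natCast]
    rw [e2, D.leibniz, e1, D.map_add, D.leibniz, D.leibniz, D.leibniz_pow, h3, h9]
    simp only [smul_eq_mul, nsmul_eq_mul]
    push_cast
    ring
  rw [e3, e2, e1] at h
  refine mul_left_cancel₀ (pow_ne_zero 3 he) ?_
  rw [hDDf, hDf, hf]
  linear_combination h

lemma logDeriv_relations [IsDomain A] (h7 : (7 : A) = 0) {P ε x y : A} (hε0 : ε ≠ 0)
    (hε : ε ^ 2 = x + y) (hx : D x = 5 * x * (P - ε)) (hy : D y = 5 * y * (P + 2 * ε))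
    (hP : D (D P) + 3 * P * D P + P ^ 3 = 1)
    (hW : D (D (P + ε)) + 3 * (P + ε) * D (P + ε) + (P + ε) ^ 3 = 1) :
    ε * (x - y) = 1 ∧ P = (x + 4 * y) ^ 2 := by
  have h2 : (2 : A) ≠ 0 := fun h ↦ one_ne_zero (α := A) (by linear_combination h7 - 3 * h)
  have hn (n : ℕ) : D (n : A) = 0 := D.map_natCast n
  have hn2 : D 2 = 0 := by simpa using hn 2
  have hn3 : D 3 = 0 := by simpa using hn 3
  have hn4 : D 4 = 0 := by simpa using hn 4
  have hDε : D ε = -P * ε + x - 2 * y := by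
    have h := congrArg D hε
    rw [D.map_add, hx, hy, D.leibniz_pow] at h
    simp only [smul_eq_mul, nsmul_eq_mul] at h
    push_cast at h
    refine mul_left_cancel₀ (mul_ne_zero h2 hε0) ?_
    linear_combination h - 5 * P * hε + h7 * (P * ε ^ 2 - x * ε + 2 * y * ε)
  have hDDε : D (D ε) = -D P * ε - P * D ε + D x - 2 * D y := by
    rw [hDε, D.map_sub, D.map_add, D.leibniz, D.leibniz, D.map_neg, hn2, hDε]
    simp only [smul_eq_mul]
    ring
  have hDP : D P = 3 * (P ^ 2 - (x + 4 * y)) := by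
    have h : ε * (2 * D P + P ^ 2 - x - 4 * y) = 0 := by
      rw [D.map_add, D.map_add, hDDε, hDε, hx, hy] at hW
      linear_combination hW - hP - h7 * (P * (x - 2 * y)) + 3 * h7 * y * ε - ε * hε
    refine mul_left_cancel₀ h2 ?_
    linear_combination (mul_eq_zero.mp h).resolve_left hε0 - h7 * (P ^ 2 - x - 4 * y)
  have hDDP : D (D P) = 3 * (2 * P * D P - D x - 4 * D y) := by
    rw [hDP, D.leibniz, D.map_sub, D.map_add, D.leibniz_pow, D.leibniz, hn3, hn4, hDP]
    simp only [smul_eq_mul, nsmul_eq_mul]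
    push_cast
    ring
  have h1 : ε * (x - y) = 1 := by
    rw [hDDP, hDP, hx, hy] at hP
    linear_combination hP +
      h7 * (-2 * ε * x + 17 * ε * y + 6 * x * P + 24 * y * P - 4 * P ^ 3)
  refine ⟨h1, ?_⟩
  have h := congrArg D h1
  rw [D.leibniz, D.map_sub, hx, hy, hDε, D.map_one_eq_zero] at h
  simp only [smul_eq_mul] at h
  refine mul_left_cancel₀ (mul_ne_zero h2 h2) ?_
  linear_combination h - 4 * P * h1 + (5 * x + 10 * y) * hε - h7 * (2 * x * y + 8 * y ^ 2)

end

section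

variable {R A : Type*} [CommRing R] [CommRing A] [Algebra R A] (D : Derivation R A A)

lemma derivation_sum_eq (h7 : (7 : A) = 0) {P ε x y : A} (hε : ε ^ 2 = x + y)
    (hx : D x = 5 * x * (P - ε)) (hy : D y = 5 * y * (P + 2 * ε)) (h1 : ε * (x - y) = 1)
    (hP : P = (x + 4 * y) ^ 2) :
    D (x + y) = 2 * (1 - (x + y) ^ 3) := by
  have hε' : ε = (x + y) * (x - y) := by linear_combination -ε * h1 + (x - y) * hε
  rw [D.map_add, hx, hy, hP]
  rw [hε'] at h1 ⊢
  linear_combination h7 * (x + y) * (9 * x * y + 10 * y ^ 2) + 2 * h1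

lemma iterate_derivation_sub_id (h7 : (7 : A) = 0) {c s t : A} (hst : s * t = 1)
    (hs : D s = 2 * (1 - s ^ 3)) (hc : D c = (1 + (4 * s ^ 2 + 2 * t)) * c) :
    (fun f ↦ D f - f)^[6] c = c - c * (2 * (s ^ 2 - t) * s ^ 7) := by
  have h2 : D 2 = 0 := by simpa using D.map_natCast 2
  have h3 : D 3 = 0 := by simpa using D.map_natCast 3
  have h4 : D 4 = 0 := by simpa using D.map_natCast 4
  have ht : D t = 2 * (s - t ^ 2) := by
    have h := congrArg D hst
    rw [D.leibniz, hs, D.map_one_eq_zero] at h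
    simp only [smul_eq_mul] at h
    linear_combination t * h - (D t - 2 * s ^ 2 * t - 2 * s) * hst
  have step {g g' : A} (h : (4 * s ^ 2 + 2 * t) * g + D g = g') : D (c * g) - c * g = c * g' := by
    rw [D.leibniz, hc, ← h]
    simp only [smul_eq_mul]
    ring
  have e1 : D c - c = c * (4 * s ^ 2 + 2 * t) := by rw [hc]; ring
  have e2 : D (c * (4 * s ^ 2 + 2 * t)) - c * (4 * s ^ 2 + 2 * t) = c * s := by
    refine step ?_
    simp only [map_add, D.leibniz, D.leibniz_pow, h2, h4, hs, ht, smul_eq_mul, nsmul_eq_mul]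
    push_cast
    linear_combination 16 * s * hst + h7 * (5 * s)
  have e3 : D (c * s) - c * s = c * (4 + 2 * s ^ 3) := by
    refine step ?_
    rw [hs]
    linear_combination 2 * hst
  have e4 : D (c * (4 + 2 * s ^ 3)) - c * (4 + 2 * s ^ 3) =
      c * (4 * s ^ 2 + 3 * s ^ 5 + t) := by
    refine step ?_
    simp only [map_add, D.leibniz, D.leibniz_pow, h2, h4, hs, smul_eq_mul, nsmul_eq_mul]
    push_cast
    linear_combination 4 * s ^ 2 * hst + h7 * (4 * s ^ 2 - s ^ 5 + t)
  have e5 : D (c * (4 * s ^ 2 + 3 * s ^ 5 + t)) - c * (4 * s ^ 2 + 3 * s ^ 5 + t) =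
      c * (2 * s + 3 * s ^ 7 + s ^ 4) := by
    refine step ?_
    simp only [map_add, D.leibniz, D.leibniz_pow, h3, h4, hs, ht, smul_eq_mul, nsmul_eq_mul]
    push_cast
    linear_combination (12 * s + 6 * s ^ 4) * hst + h7 * (4 * s + 5 * s ^ 4 - 3 * s ^ 7)
  have e6 : D (c * (2 * s + 3 * s ^ 7 + s ^ 4)) - c * (2 * s + 3 * s ^ 7 + s ^ 4) =
      c - c * (2 * (s ^ 2 - t) * s ^ 7) := by
    rw [step (g' := 1 + 2 * s ^ 6 - 2 * s ^ 9)]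
    · linear_combination -2 * c * s ^ 6 * hst
    simp only [map_add, D.leibniz, D.leibniz_pow, h2, h3, hs, smul_eq_mul, nsmul_eq_mul]
    push_cast
    linear_combination (4 + 2 * s ^ 3 + 6 * s ^ 6) * hst +
      h7 * (1 + 2 * s ^ 3 + 6 * s ^ 6 - 4 * s ^ 9)
  simp only [Function.iterate_succ, Function.iterate_zero, Function.comp_apply, id_eq, e1, e2, e3,
    e4, e5, e6]

end

section

variable {R A : Type*} [CommRing R] [CommRing A] [Algebra R A] (D : Derivation R A A)

lemma derivation_of_mul_eq_one {e i p : A} (he : D e = p * e) (hi : e * i = 1) :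
    D i = -p * i := by
  have h := congrArg D hi
  rw [D.leibniz, D.map_one_eq_zero, he] at h
  simp only [smul_eq_mul] at h
  linear_combination i * h - (D i + p * i) * hi

lemma derivation_pow_seven_mul (h7 : (7 : A) = 0) (u f : A) : D (u ^ 7 * f) = u ^ 7 * D f := by
  rw [D.leibniz, D.leibniz_pow]
  simp only [smul_eq_mul, nsmul_eq_mul]
  push_cast
  linear_combination f * u ^ 6 * D u * h7

end

instance fact_prime_seven : Fact (Nat.Prime 7) := ⟨by norm_num⟩

lemma coeff_mul_pow_self (p : ℕ) [hp : Fact p.Prime] (f : (ZMod p)⟦X⟧) (m : ℕ) :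
    coeff (p * m) (f ^ p) = coeff m f := by
  have h := MvPowerSeries.map_frobenius_expand p hp.out.ne_zero (f := f)
  rw [ZMod.frobenius_zmod] at h
  rw [← coeff_expand_mul p hp.out.ne_zero f m]
  exact congrArg (coeff (p * m)) (h.symm.trans (by simp; rfl))

section

variable (R : Type*) [CommRing R]

lemma eulerOp_cube_monomial (k w : ℕ) (c : R) :
    eulerOp R (eulerOp R (eulerOp R (monomial w c))) +
      3 * k * eulerOp R (eulerOp R (monomial w c)) + 3 * k ^ 2 * eulerOp R (monomial w c) =
      monomial w (((w + k) ^ 3 - k ^ 3) * c) := by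
  simp only [eulerOp_monomial]
  rw [← map_ofNat (C (R := R)), ← map_natCast (C (R := R)), ← map_pow, ← map_mul, ← map_mul]
  ext n
  simp only [map_add, coeff_C_mul, coeff_monomial]
  split_ifs
  · ring
  · simp

variable [CharP R 7]

lemma seven_eq_zero : (7 : R⟦X⟧) = 0 := by
  have h := CharP.cast_eq_zero R 7
  rw [Nat.cast_ofNat] at h
  rw [← map_ofNat (C (R := R)), h, map_zero]

lemma triangle_cube_eq (j : ℤ) : (((triangle j : R) + 1) ^ 3 - 1) * (2 * (j : R) + 1) = 0 := by
  have h := congrArg (Int.cast (R := R)) (two_mul_triangle j)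
  have h7 := CharP.cast_eq_zero R 7
  have hfrob := map_intCast (frobenius R 7) (2 * j + 1)
  rw [frobenius_def] at hfrob
  push_cast at h h7 hfrob
  have hv : (triangle j : R) + 1 = (2 * j + 1) ^ 2 := by
    linear_combination 4 * h - triangle j * h7
  rw [hv]
  linear_combination hfrob

lemma eulerOp_cube_euler [TopologicalSpace R] [IsTopologicalRing R] [T2Space R] {k : ℕ}
    (hk : 0 < k) :
    eulerOp R (eulerOp R (eulerOp R (euler R k ^ 3))) +
      3 * k * eulerOp R (eulerOp R (euler R k ^ 3)) + 3 * k ^ 2 * eulerOp R (euler R k ^ 3) =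
      0 := by
  have := WithPiTopology.instIsTopologicalRing (R := R)
  have := WithPiTopology.instT2Space (R := R)
  have h0 := (hasSum_triangleSeries R hk fun j ↦ altSign R j * (2 * j + 1)).mul_left 4
  have h8 : 4 * (2 * euler R k ^ 3) = euler R k ^ 3 := by
    linear_combination euler R k ^ 3 * seven_eq_zero R
  rw [triangleSeries_altSign_mul_two_mul_add_one R hk, h8] at h0
  have h1 := hasSum_eulerOp h0
  have h2 := hasSum_eulerOp h1
  refine (((hasSum_eulerOp h2).add (h2.mul_left (3 * (k : R⟦X⟧)))).add
    (h1.mul_left (3 * (k : R⟦X⟧) ^ 2))).unique ((hasSum_congr fun j ↦ ?_).mpr hasSum_zero)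
  rw [four_mul_monomial, eulerOp_cube_monomial]
  refine (congrArg _ ?_).trans (map_zero _)
  push_cast
  linear_combination 4 * (k : R) ^ 3 * altSign R j * triangle_cube_eq R j

end

section

variable {R A : Type*} [CommRing R] [CommRing A] [Algebra R A] (D : Derivation R A A)

/-- If `(D + 1) ^ 3` fixes `f` and `(D + 2) ^ 3` fixes `g`, up to multiples of seven, then
`(D + 1) ^ 3` fixes `S` as soon as `v ^ 7 * S = u ^ 7 * f + q * w ^ 7 * g` with `D q = q`. -/
lemma cube_derivation_eq_zero [IsDomain A] (h7 : (7 : A) = 0) {q u v w f g S : A} (hq : D q = q)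
    (hv : v ≠ 0) (hS : v ^ 7 * S = u ^ 7 * f + w ^ 7 * (q * g))
    (hf : D (D (D f)) + 3 * D (D f) + 3 * D f = 0)
    (hg : D (D (D g)) + 6 * D (D g) + 12 * D g = 0) :
    D (D (D S)) + 3 * D (D S) + 3 * D S = 0 := by
  have hDq (g : A) : D (q * g) = q * (D g + g) := by
    rw [D.leibniz, hq]
    simp only [smul_eq_mul]
    ring
  have h1 := congrArg D hS
  simp only [map_add, derivation_pow_seven_mul D h7, hDq] at h1
  have h2 := congrArg D h1
  simp only [map_add, derivation_pow_seven_mul D h7, hDq] at h2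
  have h3 := congrArg D h2
  simp only [map_add, derivation_pow_seven_mul D h7, hDq] at h3
  refine mul_left_cancel₀ (pow_ne_zero 7 hv) ?_
  linear_combination h3 + 3 * h2 + 3 * h1 + u ^ 7 * hf + w ^ 7 * q * hg + w ^ 7 * q * g * h7

lemma exists_iterate_derivation_eq [IsDomain A] (h7 : (7 : A) = 0) {q e₁ e₂ i₁ i₂ p₁ p₂ : A}
    (hq : D q = q) (h₁ : e₁ * i₁ = 1) (h₂ : e₂ * i₂ = 1) (hD₁ : D e₁ = p₁ * e₁)
    (hD₂ : D e₂ = p₂ * e₂) (hε : 1 + 24 * p₂ - 24 * p₁ ≠ 0)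
    (hsq : e₁ ^ 8 * e₂ ^ 8 * (1 + 24 * p₂ - 24 * p₁) ^ 2 = e₁ ^ 24 + 64 * q * e₂ ^ 24)
    (hJ₁ : D (D (D (e₁ ^ 3))) + 3 * D (D (e₁ ^ 3)) + 3 * D (e₁ ^ 3) = 0)
    (hJ₂ : D (D (D (e₂ ^ 3))) + 6 * D (D (e₂ ^ 3)) + 12 * D (e₂ ^ 3) = 0) :
    ∃ S, (e₁ * e₂) ^ 7 * S = (e₁ ^ 3) ^ 7 * e₁ ^ 3 + (e₂ ^ 3) ^ 7 * (q * e₂ ^ 3) ∧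
      (fun f ↦ D f - f)^[6] (i₁ * i₂) = i₁ * i₂ - q * S ^ 7 := by
  have he₁ : e₁ ≠ 0 := left_ne_zero_of_mul_eq_one h₁
  have he₂ : e₂ ≠ 0 := left_ne_zero_of_mul_eq_one h₂
  have hDi₁ := derivation_of_mul_eq_one D hD₁ h₁
  have hDi₂ := derivation_of_mul_eq_one D hD₂ h₂
  have hJ₁' := chazy_of_cube D 1 D.map_one_eq_zero he₁ hD₁ rfl (by linear_combination hJ₁)
  have hJ₂' := chazy_of_cube D 2 (by simpa using D.map_natCast 2) he₂ hD₂ rfl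
    (by linear_combination hJ₂)
  obtain ⟨x, hx⟩ : ∃ x, x = e₁ ^ 16 * i₂ ^ 8 := ⟨_, rfl⟩
  obtain ⟨y, hy⟩ : ∃ y, y = q * e₂ ^ 16 * i₁ ^ 8 := ⟨_, rfl⟩
  obtain ⟨ε, hεdef⟩ : ∃ ε, ε = 1 + 24 * p₂ - 24 * p₁ := ⟨_, rfl⟩
  obtain ⟨P, hPdef⟩ : ∃ P, P = 1 + 3 * p₁ := ⟨_, rfl⟩
  have h₁' (n : ℕ) : e₁ ^ n * i₁ ^ n = 1 := by rw [← mul_pow, h₁, one_pow]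
  have h₂' (n : ℕ) : e₂ ^ n * i₂ ^ n = 1 := by rw [← mul_pow, h₂, one_pow]
  have hW : 2 + 3 * p₂ = P + ε := by
    rw [hPdef, hεdef]
    linear_combination (3 * p₁ - 3 * p₂) * h7
  rw [← hPdef] at hJ₁'
  rw [hW] at hJ₂'
  rw [← hεdef] at hsq hε
  have hsum : ε ^ 2 = x + y := by
    refine mul_left_cancel₀ (mul_ne_zero (pow_ne_zero 8 he₁) (pow_ne_zero 8 he₂)) ?_
    rw [hx, hy]
    linear_combination hsq - e₁ ^ 24 * h₂' 8 - q * e₂ ^ 24 * h₁' 8 + 9 * q * e₂ ^ 24 * h7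
  have hDx : D x = 5 * x * (P - ε) := by
    rw [hx, D.leibniz, derivation_pow_of_eq_mul D hD₁, derivation_pow_of_eq_mul D hDi₂, hPdef,
      hεdef]
    simp only [smul_eq_mul]
    push_cast
    linear_combination -e₁ ^ 16 * i₂ ^ 8 * (17 * p₁ - 16 * p₂) * h7
  have hDy : D y = 5 * y * (P + 2 * ε) := by
    rw [hy, D.leibniz, D.leibniz, hq, derivation_pow_of_eq_mul D hD₂,
      derivation_pow_of_eq_mul D hDi₁, hPdef, hεdef]
    simp only [smul_eq_mul]
    push_cast
    linear_combination -q * e₂ ^ 16 * i₁ ^ 8 * (2 + 32 * p₂ - 31 * p₁) * h7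
  obtain ⟨hone, hP⟩ := logDeriv_relations D h7 hε hsum hDx hDy (by linear_combination hJ₁')
    (by linear_combination hJ₂' + h7)
  have hε' : ε = (x + y) * (x - y) := by linear_combination -ε * hone + (x - y) * hsum
  have hc : D (i₁ * i₂) = (1 + (4 * (x + y) ^ 2 + 2 * (x - y) ^ 2)) * (i₁ * i₂) := by
    have hL : 4 * P + 2 * ε = 4 * (x + y) ^ 2 + 2 * (x - y) ^ 2 := by
      rw [hP, hε']
      linear_combination (4 * x * y + 8 * y ^ 2) * h7
    rw [D.leibniz, hDi₁, hDi₂, ← hL, hPdef, hεdef]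
    simp only [smul_eq_mul]
    linear_combination -(1 - 5 * p₁ + 7 * p₂) * i₁ * i₂ * h7
  refine ⟨e₁ * e₂ * (x + y), ?_, ?_⟩
  · rw [← hsum]
    linear_combination hsq + 9 * q * e₂ ^ 24 * h7
  · rw [iterate_derivation_sub_id D h7 (s := x + y) (t := (x - y) ^ 2) ?_
      (derivation_sum_eq D h7 hsum hDx hDy hone hP) hc]
    · have hxy : i₁ * i₂ * (x * y) = q * (e₁ ^ 7 * e₂ ^ 7) := by
        rw [hx, hy]
        linear_combination q * i₁ ^ 9 * e₁ ^ 16 * e₂ ^ 7 * h₂' 9 + q * e₁ ^ 7 * e₂ ^ 7 * h₁' 9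
      linear_combination -(x + y) ^ 7 * hxy - i₁ * i₂ * x * y * (x + y) ^ 7 * h7
    · rw [← hsum]
      linear_combination (ε * (x - y) + 1) * hone

end

lemma coeff_iterate_eulerOp_sub_id (R : Type*) [CommRing R] (f : R⟦X⟧) (n k : ℕ) :
    coeff n ((fun f ↦ eulerOp R f - f)^[k] f) = (n - 1) ^ k * coeff n f := by
  induction k generalizing f with
  | zero => simp
  | succ k ih =>
    rw [Function.iterate_succ_apply, ih, map_sub, coeff_eulerOp]
    ring

theorem exists_iterate_eulerOp_eq (R : Type*) [CommRing R] [CharP R 7] [IsDomain R]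
    [TopologicalSpace R] [IsTopologicalRing R] [T2Space R] {c : R⟦X⟧}
    (hc : c * (euler R 1 * euler R 2) = 1) :
    ∃ S : R⟦X⟧, eulerOp R (eulerOp R (eulerOp R S)) + 3 * eulerOp R (eulerOp R S) +
        3 * eulerOp R S = 0 ∧
      (fun f ↦ eulerOp R f - f)^[6] c = c - X * S ^ 7 := by
  have h7 := seven_eq_zero R
  have h2 : (2 : R) ≠ 0 := fun h ↦ by
    have h7 := CharP.cast_eq_zero R 7
    push_cast at h7
    exact one_ne_zero (α := R) (by linear_combination h7 - 3 * h)
  obtain ⟨i₁, h₁⟩ := (isUnit_euler R one_pos).exists_right_inv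
  obtain ⟨i₂, h₂⟩ := (isUnit_euler R two_pos).exists_right_inv
  obtain ⟨p₁, hp₁⟩ := exists_eulerOp_eq_mul_euler R one_pos
  obtain ⟨p₂, hp₂⟩ := exists_eulerOp_eq_mul_euler R two_pos
  have hX : eulerOp R (X : R⟦X⟧) = X := by
    rw [X_eq, eulerOp_monomial]
    simp
  have hJ₁ := eulerOp_cube_euler R one_pos
  have hJ₂ := eulerOp_cube_euler R two_pos
  push_cast at hJ₁ hJ₂
  have hJ₁' : eulerOp R (eulerOp R (eulerOp R (euler R 1 ^ 3))) +
      3 * eulerOp R (eulerOp R (euler R 1 ^ 3)) + 3 * eulerOp R (euler R 1 ^ 3) = 0 := by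
    linear_combination hJ₁
  have hJ₂' : eulerOp R (eulerOp R (eulerOp R (euler R 2 ^ 3))) +
      6 * eulerOp R (eulerOp R (euler R 2 ^ 3)) + 12 * eulerOp R (euler R 2 ^ 3) = 0 := by
    linear_combination hJ₂
  have hsq := sq_logDeriv_euler R h2 hp₁ hp₂
  have hε : 1 + 24 * p₂ - 24 * p₁ ≠ 0 := fun h ↦ by
    have h' := congrArg constantCoeff hsq
    rw [h] at h'
    simp [constantCoeff_euler] at h'
  obtain ⟨S, hS, hiter⟩ := exists_iterate_derivation_eq (eulerOp R) h7 hX h₁ h₂ hp₁ hp₂ hε hsq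
    hJ₁' hJ₂'
  refine ⟨S, cube_derivation_eq_zero (eulerOp R) h7 hX
    (mul_ne_zero (isUnit_euler R one_pos).ne_zero (isUnit_euler R two_pos).ne_zero) hS hJ₁'
    hJ₂', ?_⟩
  have hci : c = i₁ * i₂ := by
    linear_combination i₁ * i₂ * hc - c * h₁ - c * euler R 1 * i₁ * h₂
  rw [hci, hiter]

theorem coeff_eq_zero_of_mul_euler_eq_one {c : (ZMod 7)⟦X⟧}
    (hc : c * (euler (ZMod 7) 1 * euler (ZMod 7) 2) = 1) (n : ℕ) :
    coeff (49 * n + 36) c = 0 := by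
  obtain ⟨S, hS, hiter⟩ := exists_iterate_eulerOp_eq (ZMod 7) hc
  have h7 : (7 : ZMod 7) = 0 := rfl
  have hSn : coeff (7 * n + 5) S = 0 := by
    have h := congrArg (coeff (7 * n + 5)) hS
    have h5 : ((7 * n + 5 : ℕ) : ZMod 7) = 5 := by
      push_cast
      linear_combination n * h7
    rw [← map_ofNat (C (R := ZMod 7))] at h
    simp only [map_add, coeff_C_mul, coeff_eulerOp, map_zero, h5] at h
    linear_combination 3 * h - 92 * coeff (7 * n + 5) S * h7
  have h := congrArg (coeff (7 * (7 * n + 5) + 1)) hiter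
  have h1 : ((7 * (7 * n + 5) + 1 : ℕ) : ZMod 7) = 1 := by
    push_cast
    linear_combination (7 * n + 5) * h7
  rw [coeff_iterate_eulerOp_sub_id, h1, map_sub, coeff_succ_X_mul, coeff_mul_pow_self, hSn] at h
  rw [show 49 * n + 36 = 7 * (7 * n + 5) + 1 by ring]
  linear_combination -h

theorem mk_card_restricted_dvd_mul_euler (R : Type*) [CommRing R] [TopologicalSpace R]
    [IsTopologicalRing R] [T2Space R] {k : ℕ} (hk : 0 < k) :
    PowerSeries.mk (fun n ↦ (#(Nat.Partition.restricted n (k ∣ ·)) : R)) * euler R k = 1 := by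
  have h := Nat.Partition.hasProd_powerSeriesMk_card_restricted R (k ∣ ·)
  have hg (m : ℕ) : k * (m + 1) - 1 + 1 = k * (m + 1) :=
    Nat.sub_add_cancel (Nat.mul_pos hk m.succ_pos)
  have hinj : Function.Injective fun m ↦ k * (m + 1) - 1 := fun a b hab ↦ by
    have hab' := congrArg (· + 1) hab
    simp only [hg] at hab'
    exact Nat.succ_injective (Nat.eq_of_mul_eq_mul_left hk hab')
  rw [← hinj.hasProd_iff] at h
  · refine mul_eq_of_tendsto h.tendsto_prod_nat (tendsto_eulerFin R hk) tendsto_const_nhds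
      fun N ↦ ?_
    rw [eulerFin, ← prod_mul_distrib]
    refine prod_eq_one fun i _ ↦ ?_
    simp only [Function.comp_apply, hg, dvd_mul_right, if_true, pow_mul _ (k * _)]
    exact WithPiTopology.tsum_pow_mul_one_sub_of_constantCoeff_eq_zero (by simp [hk.ne'])
  · intro i hi
    refine if_neg fun ⟨m, hm⟩ ↦ hi ?_
    rcases m with _ | m
    · omega
    · exact ⟨m, (congrArg (· - 1) hm).symm⟩

theorem mk_cubicPartition_mul_euler (R : Type*) [CommRing R] [TopologicalSpace R]
    [IsTopologicalRing R] [T2Space R] :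
    PowerSeries.mk (fun n ↦ (cubicPartition n : R)) * (euler R 1 * euler R 2) = 1 := by
  have h : PowerSeries.mk (fun n ↦ (cubicPartition n : R)) =
      PowerSeries.mk (fun n ↦ (#(Nat.Partition.restricted n (1 ∣ ·)) : R)) *
        PowerSeries.mk (fun n ↦ (#(Nat.Partition.restricted n (2 ∣ ·)) : R)) := by
    ext n
    rw [coeff_mul, Nat.sum_antidiagonal_eq_sum_range_succ_mk]
    simp only [coeff_mk, cubicPartition, Nat.cast_sum, Nat.cast_mul]
    refine sum_congr rfl fun j _ ↦ ?_
    rw [Fintype.card_subtype]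
    simp [Nat.Partition.restricted, even_iff_two_dvd]
  rw [h, mul_mul_mul_comm, mk_card_restricted_dvd_mul_euler R one_pos,
    mk_card_restricted_dvd_mul_euler R two_pos, one_mul]

end CubicPartition

theorem cubicPartition_mod_seven_36 (n : ℕ) : 7 ∣ cubicPartition (49 * n + 36) := by
  rw [← CharP.cast_eq_zero_iff (ZMod 7) 7]
  have h := CubicPartition.coeff_eq_zero_of_mul_euler_eq_one
    (CubicPartition.mk_cubicPartition_mul_euler (ZMod 7)) n
  rwa [PowerSeries.coeff_mk] at h
end

section
/- Let a(n) be the cubic partition function. Then for every nonnegative integer n, a(49n+43) ≡ 0 (mod 7). -/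
section cubicPartition
open PowerSeries Finset

/-- Gaussian binomial coefficients at `Q`, defined by the `Q`-Pascal rule. -/
def gaussBinom {R : Type*} [CommRing R] (Q : R) : ℕ → ℕ → R
  | _, 0 => 1
  | 0, _ + 1 => 0
  | n + 1, k + 1 => gaussBinom Q n k + Q ^ (k + 1) * gaussBinom Q n (k + 1)

section gaussBinom
variable {R : Type*} [CommRing R] (Q : R)

@[simp] lemma gaussBinom_zero_right (n : ℕ) : gaussBinom Q n 0 = 1 := by
  cases n <;> rfl

lemma gaussBinom_succ_succ (n k : ℕ) : gaussBinom Q (n + 1) (k + 1) =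
    gaussBinom Q n k + Q ^ (k + 1) * gaussBinom Q n (k + 1) := rfl

lemma gaussBinom_eq_zero_of_lt {n k : ℕ} (h : n < k) : gaussBinom Q n k = 0 := by
  induction n generalizing k with
  | zero => obtain ⟨k, rfl⟩ := Nat.exists_eq_succ_of_ne_zero h.ne'; rfl
  | succ n ih =>
    obtain ⟨k, rfl⟩ := Nat.exists_eq_succ_of_ne_zero (Nat.ne_zero_of_lt h)
    rw [Nat.succ_eq_add_one, gaussBinom_succ_succ, ih (by omega), ih (by omega)]
    ring

lemma gaussBinom_self (n : ℕ) : gaussBinom Q n n = 1 := by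
  induction n with
  | zero => rfl
  | succ n ih => rw [gaussBinom_succ_succ, ih, gaussBinom_eq_zero_of_lt Q n.lt_succ_self]; ring

/-- `(1 - Q) (1 - Q ^ 2) ⋯ (1 - Q ^ n)` -/
def qPoch (n : ℕ) : R := ∏ i ∈ range n, (1 - Q ^ (i + 1))

lemma qPoch_succ (n : ℕ) : qPoch Q (n + 1) = qPoch Q n * (1 - Q ^ (n + 1)) :=
  prod_range_succ ..

lemma gaussBinom_add_mul (a b : ℕ) :
    gaussBinom Q (a + b) a * (qPoch Q a * qPoch Q b) = qPoch Q (a + b) := by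
  induction h : a + b generalizing a b with
  | zero =>
    obtain ⟨rfl, rfl⟩ : a = 0 ∧ b = 0 := by omega
    simp [qPoch]
  | succ n ih =>
    rcases a with _ | a
    · obtain rfl : b = n + 1 := by omega
      simp [qPoch]
    rcases b with _ | b
    · obtain rfl : a = n := by omega
      simp [qPoch, gaussBinom_self]
    have h1 := ih a (b + 1) (by omega)
    have h2 := ih (a + 1) b (by omega)
    obtain rfl : n = a + b + 1 := by omega
    rw [qPoch_succ] at h1 h2
    rw [gaussBinom_succ_succ, qPoch_succ Q (a + b + 1), qPoch_succ Q a, qPoch_succ Q b]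
    linear_combination (1 - Q ^ (a + 1)) * h1 + Q ^ (a + 1) * (1 - Q ^ (b + 1)) * h2

theorem prod_add_mul_pow_eq_sum_gaussBinom (n : ℕ) (x y : R) :
    ∏ i ∈ range n, (y + x * Q ^ i) =
      ∑ k ∈ range (n + 1), Q ^ k.choose 2 * gaussBinom Q n k * x ^ k * y ^ (n - k) := by
  induction n generalizing x with
  | zero => simp
  | succ n ih =>
    have hx : ∏ i ∈ range n, (y + x * Q ^ (i + 1)) = ∏ i ∈ range n, (y + x * Q * Q ^ i) :=
      prod_congr rfl fun i _ ↦ by ring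
    rw [prod_range_succ', hx, ih, sum_range_succ' _ (n + 1), pow_zero, mul_one, mul_add]
    have h1 : (∑ k ∈ range (n + 1), Q ^ k.choose 2 * gaussBinom Q n k * (x * Q) ^ k *
        y ^ (n - k)) * y = (∑ k ∈ range (n + 1), Q ^ (k + 1).choose 2 *
          (Q ^ (k + 1) * gaussBinom Q n (k + 1)) * x ^ (k + 1) * y ^ (n - k)) + y ^ (n + 1) := by
      rw [sum_range_succ', sum_range_succ _ n, gaussBinom_eq_zero_of_lt Q n.lt_succ_self, add_mul,
        sum_mul]
      simp only [Nat.choose_zero_succ, pow_zero, gaussBinom_zero_right, Nat.sub_zero, mul_zero,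
        zero_mul, add_zero, one_mul, ← pow_succ]
      congr 1
      refine sum_congr rfl fun k hk ↦ ?_
      rw [show n - k = n - (k + 1) + 1 by grind]
      ring
    have h2 : (∑ k ∈ range (n + 1), Q ^ k.choose 2 * gaussBinom Q n k * (x * Q) ^ k *
        y ^ (n - k)) * x = ∑ k ∈ range (n + 1), Q ^ (k + 1).choose 2 *
          gaussBinom Q n k * x ^ (k + 1) * y ^ (n - k) := by
      rw [sum_mul]
      refine sum_congr rfl fun k _ ↦ ?_
      rw [Nat.choose_succ_succ' k 1, Nat.choose_one_right]
      ring
    rw [h1, h2, add_right_comm, ← sum_add_distrib]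
    congr 1
    · refine sum_congr rfl fun k _ ↦ ?_
      rw [gaussBinom_succ_succ, Nat.add_sub_add_right]
      ring
    · simp

end gaussBinom

/-- The theta series `∑ s ^ |a| q ^ (a ^ 2)`, the sum being over all integers `a`. -/
noncomputable def thetaSeries {R : Type*} [CommRing R] (s : R) : R⟦X⟧ :=
  .mk fun n ↦ ∑ a ∈ Icc (-(n : ℤ)) n with a ^ 2 = (n : ℤ), s ^ a.natAbs

section Gauss
variable (K : Type*) [CommRing K] [IsDomain K]

lemma sum_gaussBinom_eq_prod_one_sub_X_pow_odd_sq (n : ℕ) :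
    ∑ k ∈ range (2 * n + 1), (-1) ^ (k + n) * (X : K⟦X⟧) ^ (((k : ℤ) - n).natAbs ^ 2) *
      gaussBinom (X ^ 2) (2 * n) k = (∏ k ∈ range n, (1 - X ^ (2 * k + 1))) ^ 2 := by
  have h := prod_add_mul_pow_eq_sum_gaussBinom (X ^ 2) (2 * n) (-X) ((X : K⟦X⟧) ^ (2 * n))
  have h1 : ∏ i ∈ range n, ((X : K⟦X⟧) ^ (2 * n) + -X * (X ^ 2) ^ i) =
      (-1) ^ n * X ^ n ^ 2 * ∏ k ∈ range n, (1 - X ^ (2 * k + 1)) := by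
    have h2 : ∀ i ∈ range n, (X : K⟦X⟧) ^ (2 * n) + -X * (X ^ 2) ^ i =
        -1 * X ^ (2 * i + 1) * (1 - X ^ (2 * (n - 1 - i) + 1)) := by
      intro i hi
      obtain ⟨j, rfl⟩ : ∃ j, n = i + 1 + j := ⟨n - 1 - i, by grind⟩
      rw [show i + 1 + j - 1 - i = j by omega]
      ring
    rw [prod_congr rfl h2, prod_mul_distrib, prod_mul_distrib, prod_const, card_range,
      prod_range_reflect (fun k ↦ 1 - (X : K⟦X⟧) ^ (2 * k + 1)) n, prod_pow_eq_pow_sum,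
      sum_add_distrib, ← mul_sum, sum_const, card_range, smul_eq_mul, mul_one]
    congr 3
    have := sum_range_id_mul_two n
    rcases n with _ | n
    · simp
    · rw [mul_comm, this, Nat.add_sub_cancel]; ring
  have h2 : ∏ i ∈ range n, ((X : K⟦X⟧) ^ (2 * n) + -X * (X ^ 2) ^ (n + i)) =
      X ^ (2 * n ^ 2) * ∏ k ∈ range n, (1 - X ^ (2 * k + 1)) := by
    rw [show 2 * n ^ 2 = 2 * n * n by ring, pow_mul _ (2 * n)]
    have h3 : ((X : K⟦X⟧) ^ (2 * n)) ^ n = ∏ _i ∈ range n, X ^ (2 * n) := by simp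
    rw [h3, ← prod_mul_distrib]
    exact prod_congr rfl fun i _ ↦ by ring
  rw [two_mul n, prod_range_add, ← two_mul, h1, h2] at h
  have h0 : (X : K⟦X⟧) ^ (3 * n ^ 2) ≠ 0 := pow_ne_zero _ X_ne_zero
  refine mul_left_cancel₀ h0 ?_
  have h3 : ((-1 : K⟦X⟧) ^ n) * (-1) ^ n = 1 := by rw [← mul_pow]; simp
  calc _ = (-1) ^ n * ∑ k ∈ range (2 * n + 1), (X ^ 2) ^ k.choose 2 * gaussBinom (X ^ 2) (2 * n) k *
          (-X) ^ k * ((X : K⟦X⟧) ^ (2 * n)) ^ (2 * n - k) := by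
        rw [mul_sum, mul_sum]
        refine sum_congr rfl fun k hk ↦ ?_
        have he : 3 * n ^ 2 + ((k : ℤ) - n).natAbs ^ 2 =
            2 * k.choose 2 + k + 2 * n * (2 * n - k) := by
          obtain ⟨j, hj⟩ : ∃ j, 2 * n = k + j := ⟨2 * n - k, by grind⟩
          have hc : 2 * k.choose 2 + k = k ^ 2 := by
            rw [Nat.choose_two_right, Nat.mul_div_cancel' (Nat.even_mul_pred_self k).two_dvd]
            rcases k with _ | k
            · rfl
            · rw [Nat.add_sub_cancel]; ring
          rw [hc, hj, Nat.add_sub_cancel_left]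
          zify
          rw [sq_abs]
          have : (2 : ℤ) * n = k + j := mod_cast hj
          rw [← this, eq_sub_of_add_eq' this.symm]
          ring
        rw [neg_pow X k]
        calc _ = (-1) ^ n * (-1) ^ k * gaussBinom (X ^ 2) (2 * n) k *
              (X : K⟦X⟧) ^ (3 * n ^ 2 + ((k : ℤ) - n).natAbs ^ 2) := by ring
          _ = _ := by rw [he]; ring
    _ = _ := by
        rw [← h]
        linear_combination (X ^ (3 * n ^ 2) * (∏ k ∈ range n, (1 - (X : K⟦X⟧) ^ (2 * k + 1))) ^ 2) * h3

lemma qPoch_X_coeff {m n : ℕ} (h : m ≤ n) :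
    coeff m (qPoch (X : K⟦X⟧) n) = coeff m (pentagonalSeries K) := by
  have h1 : ∀ k, m ≤ k → coeff m (qPoch (X : K⟦X⟧) k) = coeff m (qPoch (X : K⟦X⟧) m) := by
    intro k hk
    induction k, hk using Nat.le_induction with
    | base => rfl
    | succ k hk ih =>
      rw [qPoch_succ, coeff_mul_one_sub_of_lt_order, ih]
      rw [order_X_pow]
      exact_mod_cast Nat.lt_succ_of_le hk
  obtain ⟨s, hs⟩ := Filter.eventually_atTop.1 (coeff_prod_one_sub_X_pow_eventually_eq K m)
  obtain ⟨k, hk⟩ := s.exists_nat_subset_range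
  have h2 := hs (range (max k m)) (hk.trans (range_mono (le_max_left _ _)))
  rw [h1 n h, ← h2]
  exact (h1 _ (le_max_right _ _)).symm

omit [IsDomain K] in
lemma expand_two_qPoch (n : ℕ) : expand 2 two_ne_zero (qPoch (X : K⟦X⟧) n) = qPoch (X ^ 2) n := by
  simp [qPoch, map_prod]

lemma X_pow_dvd_qPoch_sub {m n : ℕ} (h : m ≤ n) :
    (X : K⟦X⟧) ^ m ∣ qPoch X n - pentagonalSeries K := by
  rw [X_pow_dvd_iff]
  intro j hj
  rw [map_sub, qPoch_X_coeff K (by omega), sub_self]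

lemma X_pow_dvd_qPoch_sq_sub {m n : ℕ} (h : m ≤ n) :
    (X : K⟦X⟧) ^ m ∣ qPoch (X ^ 2) n - expand 2 two_ne_zero (pentagonalSeries K) := by
  rw [X_pow_dvd_iff, ← expand_two_qPoch, ← map_sub]
  intro j hj
  rw [coeff_expand]
  split_ifs with h2
  · exact X_pow_dvd_iff.1 (X_pow_dvd_qPoch_sub K h) _ (by omega)
  · rfl

omit [IsDomain K] in
lemma X_pow_dvd_sum_sub_thetaSeries {m n : ℕ} (h : m ≤ n) :
    (X : K⟦X⟧) ^ m ∣ ∑ k ∈ range (2 * n + 1), (-1) ^ (k + n) * X ^ (((k : ℤ) - n).natAbs ^ 2) -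
      thetaSeries (-1) := by
  rw [X_pow_dvd_iff]
  intro j hj
  have h1 (k : ℕ) : (-1 : K⟦X⟧) ^ (k + n) = C ((-1) ^ (k + n)) := by simp
  simp only [map_sub, map_sum, h1, coeff_C_mul, coeff_X_pow, thetaSeries, coeff_mk, mul_ite, mul_one,
    mul_zero]
  rw [← sum_filter, sub_eq_zero]
  refine sum_nbij' (fun k ↦ (k : ℤ) - n) (fun a ↦ (a + n).toNat) ?_ ?_ ?_ ?_ ?_
  · intro k hk
    simp only [mem_filter, mem_range, mem_Icc] at hk ⊢
    have : (j : ℤ) = ((k : ℤ) - n) ^ 2 := by rw [hk.2]; simp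
    refine ⟨⟨?_, ?_⟩, this.symm⟩ <;> nlinarith
  · intro a ha
    simp only [mem_filter, mem_range, mem_Icc] at ha ⊢
    refine ⟨by omega, ?_⟩
    zify
    rw [sq_abs, ← ha.2, Int.toNat_of_nonneg (by omega)]
    ring
  · intro k hk
    simp
  · intro a ha
    simp only [mem_filter, mem_Icc] at ha
    rw [Int.toNat_of_nonneg (by omega)]
    ring
  · intro k hk
    rw [neg_one_pow_eq_pow_mod_two, neg_one_pow_eq_pow_mod_two (n := ((k : ℤ) - n).natAbs)]
    congr 1
    omega

theorem thetaSeries_neg_one_mul_expand_pentagonalSeries :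
    thetaSeries (-1) * expand 2 two_ne_zero (pentagonalSeries K) = pentagonalSeries K ^ 2 := by
  rw [← sub_eq_zero]
  ext m
  refine X_pow_dvd_iff.1 ?_ m m.lt_succ_self
  generalize m.succ = m
  set f₁ := pentagonalSeries K
  set f₂ := expand 2 two_ne_zero f₁
  rw [← Ideal.mem_span_singleton, ← Ideal.Quotient.eq]
  set π := Ideal.Quotient.mk (Ideal.span {(X : K⟦X⟧) ^ m})
  have hπ {a b : K⟦X⟧} (h : X ^ m ∣ a - b) : π a = π b := by
    rwa [Ideal.Quotient.eq, Ideal.mem_span_singleton]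
  have h1 {n : ℕ} (h : m ≤ n) : π (qPoch X n) = π f₁ := hπ (X_pow_dvd_qPoch_sub K h)
  have h2 {n : ℕ} (h : m ≤ n) : π (qPoch (X ^ 2) n) = π f₂ := hπ (X_pow_dvd_qPoch_sq_sub K h)
  have hu : IsUnit (π f₂) := by
    refine IsUnit.map π (isUnit_iff_constantCoeff.2 ?_)
    have := qPoch_X_coeff K (le_refl 0)
    simp only [qPoch, range_zero, prod_empty, coeff_zero_eq_constantCoeff, map_one] at this
    simp [f₂, f₁, ← this]
  have h3 := congrArg π (sum_gaussBinom_eq_prod_one_sub_X_pow_odd_sq K (2 * m))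
  have h4 : π (thetaSeries (-1)) = π f₂ * π ((∏ k ∈ range (2 * m), (1 - X ^ (2 * k + 1))) ^ 2) := by
    rw [← hπ (X_pow_dvd_sum_sub_thetaSeries K (show m ≤ 2 * m by omega)), ← h3, ← map_mul, mul_sum,
      map_sum, map_sum]
    refine sum_congr rfl fun k hk ↦ ?_
    by_cases hk' : m ≤ ((k : ℤ) - (2 * m : ℕ)).natAbs ^ 2
    · have : π (X ^ (((k : ℤ) - (2 * m : ℕ)).natAbs ^ 2)) = 0 := by
        rw [Ideal.Quotient.eq_zero_iff_mem, Ideal.mem_span_singleton]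
        exact pow_dvd_pow _ hk'
      simp only [map_mul, this, mul_zero, zero_mul]
    · have h5 : ((k : ℤ) - (2 * m : ℕ)).natAbs < m := by nlinarith
      obtain ⟨b, hb⟩ : ∃ b, 2 * (2 * m) = k + b := ⟨2 * (2 * m) - k, by grind⟩
      have h6 := congrArg π (gaussBinom_add_mul ((X : K⟦X⟧) ^ 2) k b)
      rw [map_mul, map_mul, h2 (by omega), h2 (by omega), h2 (by omega), ← hb] at h6
      have h7 : π (gaussBinom (X ^ 2) (2 * (2 * m)) k) * π f₂ = 1 := by
        refine hu.mul_left_injective ?_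
        linear_combination h6
      rw [map_mul π f₂, map_mul π (_ * _)]
      linear_combination (-π ((-1) ^ (k + 2 * m) * X ^ (((k : ℤ) - (2 * m : ℕ)).natAbs ^ 2))) * h7
  have h8 : (∏ k ∈ range (2 * m), (1 - X ^ (2 * k + 1))) * qPoch ((X : K⟦X⟧) ^ 2) (2 * m) =
      qPoch X (2 * (2 * m)) := by
    generalize 2 * m = n
    induction n with
    | zero => simp [qPoch]
    | succ n ih =>
      rw [prod_range_succ, show 2 * (n + 1) = 2 * n + 1 + 1 by ring, qPoch_succ, qPoch_succ,
        qPoch_succ, ← ih]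
      ring
  have h9 := congrArg π h8
  rw [map_mul, h2 (by omega), h1 (by omega)] at h9
  rw [map_mul, map_pow, h4, ← h9, map_pow]
  ring

end Gauss

section theta
variable {R : Type*} [CommRing R]

/-- The pairs of integers with `x ^ 2 + y ^ 2 = n`. -/
noncomputable def sumTwoSquares (n : ℕ) : Finset (ℤ × ℤ) :=
  (Icc (-(n : ℤ)) n ×ˢ Icc (-(n : ℤ)) n).filter fun p ↦ p.1 ^ 2 + p.2 ^ 2 = n

@[simp] lemma mem_sumTwoSquares {n : ℕ} {p : ℤ × ℤ} :
    p ∈ sumTwoSquares n ↔ p.1 ^ 2 + p.2 ^ 2 = n := by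
  simp only [sumTwoSquares, mem_filter, mem_product, mem_Icc, and_iff_right_iff_imp]
  intro h
  have h1 := Int.le_self_sq p.1
  have h2 := Int.le_self_sq p.2
  have h3 := Int.le_self_sq (-p.1)
  have h4 := Int.le_self_sq (-p.2)
  refine ⟨⟨?_, ?_⟩, ?_, ?_⟩ <;> nlinarith

lemma coeff_thetaSeries_mul_thetaSeries (s t : R) (n : ℕ) :
    coeff n (thetaSeries s * thetaSeries t) =
      ∑ p ∈ sumTwoSquares n, s ^ p.1.natAbs * t ^ p.2.natAbs := by
  rw [coeff_mul, ← sum_fiberwise_of_maps_to (t := antidiagonal n)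
    (g := fun p : ℤ × ℤ ↦ (p.1.natAbs ^ 2, p.2.natAbs ^ 2))]
  · refine sum_congr rfl fun ij hij ↦ ?_
    simp only [thetaSeries, coeff_mk]
    rw [sum_mul_sum, ← sum_product']
    refine sum_congr ?_ fun _ _ ↦ rfl
    rw [HasAntidiagonal.mem_antidiagonal] at hij
    ext ⟨a, b⟩
    simp only [mem_product, mem_filter, mem_Icc, mem_sumTwoSquares, Prod.ext_iff]
    zify
    simp only [sq_abs]
    constructor
    · rintro ⟨⟨-, ha⟩, -, hb⟩
      exact ⟨by rw [ha, hb]; exact_mod_cast hij, ha, hb⟩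
    · rintro ⟨-, ha, hb⟩
      have h1 := Int.le_self_sq a
      have h2 := Int.le_self_sq b
      have h3 := Int.le_self_sq (-a)
      have h4 := Int.le_self_sq (-b)
      refine ⟨⟨⟨?_, ?_⟩, ha⟩, ⟨?_, ?_⟩, hb⟩ <;> nlinarith
  · intro p hp
    rw [mem_sumTwoSquares] at hp
    rw [HasAntidiagonal.mem_antidiagonal]
    zify
    simpa using hp

lemma neg_one_pow_natAbs_of_even {a b : ℤ} (h : Even (a + b)) :
    (-1 : R) ^ a.natAbs = (-1) ^ b.natAbs := by
  rw [neg_one_pow_eq_pow_mod_two, neg_one_pow_eq_pow_mod_two (n := b.natAbs)]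
  congr 1
  grind

lemma neg_one_pow_natAbs_of_odd {a b : ℤ} (h : Odd (a + b)) :
    (-1 : R) ^ a.natAbs = -(-1) ^ b.natAbs := by
  rw [show -(-1 : R) ^ b.natAbs = (-1) ^ (b.natAbs + 1) by ring, neg_one_pow_eq_pow_mod_two,
    neg_one_pow_eq_pow_mod_two (n := b.natAbs + 1)]
  congr 1
  rw [Int.odd_iff] at h
  omega

lemma parity_of_mem_sumTwoSquares {n : ℕ} {p : ℤ × ℤ} (hp : p ∈ sumTwoSquares n) :
    Even (p.1 + p.2) ↔ Even n := by
  rw [mem_sumTwoSquares] at hp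
  rw [← Int.even_coe_nat, ← hp]
  simp [Int.even_add, Int.even_pow]

/-- Parametrization of the representations of `2 * n` by those of `n`. -/
lemma sum_sumTwoSquares_two_mul (n : ℕ) (f : ℤ × ℤ → R) :
    ∑ p ∈ sumTwoSquares (2 * n), f p = ∑ p ∈ sumTwoSquares n, f (p.1 + p.2, p.1 - p.2) := by
  refine (sum_nbij' (fun p ↦ (p.1 + p.2, p.1 - p.2))
    (fun p ↦ ((p.1 + p.2) / 2, (p.1 - p.2) / 2)) ?_ ?_ ?_ ?_ ?_).symm
  · intro p hp
    rw [mem_sumTwoSquares] at hp ⊢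
    push_cast
    linear_combination 2 * hp
  · intro p hp
    obtain ⟨c, hc⟩ := (parity_of_mem_sumTwoSquares hp).2 (even_two_mul n)
    rw [mem_sumTwoSquares] at hp ⊢
    obtain ⟨x, y⟩ := p
    obtain rfl : x = c + c - y := by simp at hc; omega
    have h1 : (c + c - y + y) / 2 = c := by omega
    have h2 : (c + c - y - y) / 2 = c - y := by omega
    simp only [h1, h2]
    push_cast at hp
    linarith
  · intro p _
    ext <;> simp <;> omega
  · intro p hp
    obtain ⟨c, hc⟩ := (parity_of_mem_sumTwoSquares hp).2 (even_two_mul n)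
    ext <;> simp <;> omega
  · intro p _
    rfl

theorem thetaSeries_one_mul_thetaSeries_neg_one :
    thetaSeries (1 : R) * thetaSeries (-1) = expand 2 two_ne_zero (thetaSeries (-1) ^ 2) := by
  ext n
  rw [coeff_expand, sq, coeff_thetaSeries_mul_thetaSeries, coeff_thetaSeries_mul_thetaSeries]
  simp only [one_pow, one_mul]
  split_ifs with h
  · obtain ⟨n, rfl⟩ := h
    rw [sum_sumTwoSquares_two_mul, Nat.mul_div_cancel_left _ two_pos]
    refine sum_congr rfl fun p _ ↦ ?_
    rw [← pow_add, neg_one_pow_eq_pow_mod_two, neg_one_pow_eq_pow_mod_two (n := _ + _)]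
    congr 1
    grind
  · have hodd {p : ℤ × ℤ} (hp : p ∈ sumTwoSquares n) : Odd (p.1 + p.2) := by
      rw [← Int.not_even_iff_odd, parity_of_mem_sumTwoSquares hp, even_iff_two_dvd]
      exact h
    refine sum_involution (fun p _ ↦ p.swap) ?_ ?_ ?_ ?_
    · intro p hp
      rw [neg_one_pow_natAbs_of_odd (b := p.1) (by rw [add_comm]; exact hodd hp)]
      simp
    · intro p hp _ h
      have := hodd hp
      rw [show p.1 = p.2 from congrArg Prod.snd h] at this
      exact Int.not_even_iff_odd.2 this ⟨_, rfl⟩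
    · intro p hp
      rw [mem_sumTwoSquares] at hp ⊢
      rw [← hp]
      exact add_comm _ _
    · intro p _
      exact p.swap_swap

theorem thetaSeries_one_sq_add_thetaSeries_neg_one_sq :
    thetaSeries (1 : R) ^ 2 + thetaSeries (-1) ^ 2 =
      2 * expand 2 two_ne_zero (thetaSeries 1 ^ 2) := by
  ext n
  rw [two_mul, map_add, map_add, coeff_expand, sq, sq, coeff_thetaSeries_mul_thetaSeries,
    coeff_thetaSeries_mul_thetaSeries, coeff_thetaSeries_mul_thetaSeries]
  simp only [one_pow, mul_one]
  split_ifs with h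
  · obtain ⟨n, rfl⟩ := h
    have h1 : ∀ p ∈ sumTwoSquares (2 * n), (-1 : R) ^ p.1.natAbs * (-1) ^ p.2.natAbs = 1 := by
      intro p hp
      rw [neg_one_pow_natAbs_of_even ((parity_of_mem_sumTwoSquares hp).2 (even_two_mul n)),
        ← mul_pow]
      simp
    rw [sum_congr rfl h1, sum_sumTwoSquares_two_mul, Nat.mul_div_cancel_left _ two_pos]
  · have h1 : ∀ p ∈ sumTwoSquares n, (-1 : R) ^ p.1.natAbs * (-1) ^ p.2.natAbs = -1 := by
      intro p hp
      have : Odd (p.1 + p.2) := by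
        rw [← Int.not_even_iff_odd, parity_of_mem_sumTwoSquares hp, even_iff_two_dvd]
        exact h
      rw [neg_one_pow_natAbs_of_odd this, neg_mul, ← mul_pow]
      simp
    rw [sum_congr rfl h1]
    simp

lemma constantCoeff_thetaSeries (s : R) : constantCoeff (thetaSeries s) = 1 := by
  rw [← coeff_zero_eq_constantCoeff_apply, thetaSeries, coeff_mk]
  simp [sum_filter]

lemma coeff_one_thetaSeries (s : R) : coeff 1 (thetaSeries s) = 2 * s := by
  rw [thetaSeries, coeff_mk, show (Icc (-((1 : ℕ) : ℤ)) (1 : ℕ)).filter (fun a ↦ a ^ 2 = ((1 : ℕ) : ℤ))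
    = {-1, 1} by decide]
  simp [two_mul]

end theta

section expand
variable {K : Type*} [CommRing K] [IsDomain K]

omit [IsDomain K] in
lemma eq_C_of_expand_two_eq {f : K⟦X⟧} (h : expand 2 two_ne_zero f = f) :
    f = C (constantCoeff f) := by
  rw [← sub_eq_zero]
  set g := f - C (constantCoeff f)
  have hg : expand 2 two_ne_zero g = g := by rw [map_sub, expand_C, h]
  by_contra h0
  have h1 := congrArg order hg
  rw [order_expand, ← coe_toNat_order h0, nsmul_eq_mul] at h1
  have h2 : 2 * g.order.toNat = g.order.toNat := by exact_mod_cast h1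
  have h3 := coeff_order h0
  rw [show g.order.toNat = 0 by omega] at h3
  simp [g] at h3

lemma eq_one_of_sq_eq_expand_two {r : K⟦X⟧} (h2 : (2 : K) ≠ 0) (h0 : constantCoeff r = 1)
    (h : r ^ 2 = expand 2 two_ne_zero r) : r = 1 := by
  obtain ⟨s, rfl⟩ : ∃ s, r = 1 + s := ⟨r - 1, by ring⟩
  have hs0 : constantCoeff s = 0 := by simpa using h0
  have hs : s * (2 + s) = expand 2 two_ne_zero s := by
    rw [map_add, map_one] at h
    linear_combination h
  have hu : (2 + s).order = 0 := by
    by_contra hne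
    rw [← ne_eq, order_ne_zero_iff_constCoeff_eq_zero] at hne
    rw [map_add, hs0, add_zero, map_ofNat] at hne
    exact h2 hne
  by_contra hne
  have hne : s ≠ 0 := by simpa using hne
  have h1 := congrArg order hs
  rw [order_expand, order_mul, hu, ← coe_toNat_order hne, nsmul_eq_mul] at h1
  have h2 : s.order.toNat = 2 * s.order.toNat := by exact_mod_cast h1
  have h3 := coeff_order hne
  rw [show s.order.toNat = 0 by omega] at h3
  simp [hs0] at h3

end expand

section eulerDerivation
variable (K : Type*) [CommRing K]

/-- The derivation `q d/dq` of `K⟦q⟧`. -/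
noncomputable def eulerDerivation : Derivation K K⟦X⟧ K⟦X⟧ := (X : K⟦X⟧) • d⁄dX K

variable {K}

lemma coeff_eulerDerivation (n : ℕ) (f : K⟦X⟧) :
    coeff n (eulerDerivation K f) = n * coeff n f := by
  rw [eulerDerivation, Derivation.smul_apply, smul_eq_mul]
  rcases n with _ | n
  · simp
  · rw [coeff_succ_X_mul, coeff_derivative, mul_comm]
    push_cast
    rfl

lemma eulerDerivation_expand (p : ℕ) (hp : p ≠ 0) (f : K⟦X⟧) :
    eulerDerivation K (expand p hp f) = p * expand p hp (eulerDerivation K f) := by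
  ext n
  rw [← map_natCast (C (R := K)), coeff_C_mul, coeff_eulerDerivation, coeff_expand, coeff_expand,
    coeff_eulerDerivation]
  split_ifs with h
  · rw [← mul_assoc, ← Nat.cast_mul, Nat.mul_div_cancel' h]
  · simp

lemma coeff_one_eq_of_mul_sq_sub_sq {P M : K⟦X⟧} (hP0 : constantCoeff P = 1)
    (hM0 : constantCoeff M = 1) (f : K⟦X⟧) (hf : constantCoeff f = 1) :
    coeff 1 (f * (P ^ 2 - M ^ 2)) = 2 * (coeff 1 P - coeff 1 M) := by
  simp only [coeff_one_mul, sq, map_sub, map_mul, hP0, hM0, hf]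
  ring

/-- A functional equation under `q ↦ q ^ 2` forces a differential equation. -/
lemma wronskian_eq_of_arithmetic_geometric_mean [IsDomain K] (h2 : (2 : K) ≠ 0) {P M : K⟦X⟧}
    (hP : P + M = 2 * expand 2 two_ne_zero P) (hM : P * M = expand 2 two_ne_zero M ^ 2)
    (hP0 : constantCoeff P = 1) (hM0 : constantCoeff M = 1) (hP1 : coeff 1 P = 4)
    (hM1 : coeff 1 M = -4) :
    2 * (eulerDerivation K P * M - eulerDerivation K M * P) = P * M * (P ^ 2 - M ^ 2) := by
  have h0 (f : K⟦X⟧) : constantCoeff (eulerDerivation K f) = 0 := by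
    simpa using coeff_eulerDerivation 0 f
  have h1 (f : K⟦X⟧) : coeff 1 (eulerDerivation K f) = coeff 1 f := by
    simpa using coeff_eulerDerivation 1 f
  have h16 : (16 : K) ≠ 0 := by
    rw [show (16 : K) = 2 ^ 4 by norm_num]
    exact pow_ne_zero _ h2
  set L := 2 * (eulerDerivation K P * M - eulerDerivation K M * P) - P * M * (P ^ 2 - M ^ 2) with hL
  have hPM1 : coeff 1 (P * M * (P ^ 2 - M ^ 2)) = 16 := by
    rw [coeff_one_eq_of_mul_sq_sub_sq hP0 hM0 _ (by simp [hP0, hM0]), hP1, hM1]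
    norm_num
  have hL1 : coeff 1 L = 0 := by
    rw [hL, map_sub, hPM1, ← map_ofNat (C (R := K)), coeff_C_mul, map_sub, coeff_one_mul,
      coeff_one_mul, h0, h0, h1, h1, hP0, hM0, hP1, hM1]
    norm_num
  have hDP := congrArg (eulerDerivation K) hP
  rw [← map_ofNat (C (R := K)), ← smul_eq_C_mul, map_add, Derivation.map_smul, eulerDerivation_expand,
    smul_eq_C_mul, map_ofNat] at hDP
  have hDM := congrArg (eulerDerivation K) hM
  rw [Derivation.leibniz, Derivation.leibniz_pow, eulerDerivation_expand] at hDM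
  simp only [smul_eq_mul, nsmul_eq_mul, Nat.cast_ofNat, pow_one, Nat.add_one_sub_one] at hDP hDM
  have hLe : 16 * expand 2 two_ne_zero P * expand 2 two_ne_zero M * expand 2 two_ne_zero L =
      (P ^ 2 - M ^ 2) * L := by
    have he : expand 2 two_ne_zero L = 2 * (expand 2 two_ne_zero (eulerDerivation K P) *
        expand 2 two_ne_zero M - expand 2 two_ne_zero (eulerDerivation K M) *
        expand 2 two_ne_zero P) - expand 2 two_ne_zero P * expand 2 two_ne_zero M *
        (expand 2 two_ne_zero P ^ 2 - expand 2 two_ne_zero M ^ 2) := by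
      simp only [hL, map_sub, map_mul, map_pow, map_ofNat]
    rw [he, hL]
    generalize expand 2 two_ne_zero P = p at *
    generalize expand 2 two_ne_zero M = m at *
    generalize expand 2 two_ne_zero (eulerDerivation K P) = dp at *
    generalize expand 2 two_ne_zero (eulerDerivation K M) = dm at *
    generalize eulerDerivation K P = DP at *
    generalize eulerDerivation K M = DM at *
    clear * - hP hM hDP hDM
    grind
  by_contra hne
  rw [← ne_eq, ← sub_ne_zero, ← hL] at hne
  have hQ : (P ^ 2 - M ^ 2).order = (1 : ℕ) := by
    rw [order_eq_nat]
    refine ⟨?_, fun i hi ↦ ?_⟩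
    · rw [← one_mul (P ^ 2 - M ^ 2), coeff_one_eq_of_mul_sq_sub_sq hP0 hM0 _ (map_one _), hP1, hM1]
      convert h16
      norm_num
    · obtain rfl : i = 0 := by omega
      simp [hP0, hM0]
  have hu : (16 * expand 2 two_ne_zero P * expand 2 two_ne_zero M).order = 0 := by
    by_contra h
    rw [← ne_eq, order_ne_zero_iff_constCoeff_eq_zero] at h
    rw [map_mul, map_mul, map_ofNat, constantCoeff_expand, constantCoeff_expand, hP0, hM0] at h
    simp [h16] at h
  have h := congrArg order hLe
  rw [order_mul, order_mul (P ^ 2 - M ^ 2), hu, hQ, order_expand, ← coe_toNat_order hne, nsmul_eq_mul] at h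
  have h' : 0 + 2 * L.order.toNat = 1 + L.order.toNat := by exact_mod_cast h
  have h3 := coeff_order hne
  rw [show L.order.toNat = 1 by omega] at h3
  exact h3 hL1

end eulerDerivation

section product
variable {K : Type*} [Field K]

lemma eq_of_sq_mul_expand_two_eq (h2 : (2 : K) ≠ 0) {f g : K⟦X⟧} {c : K} (hc : c ≠ 0)
    (hf : constantCoeff f = c) (hg : constantCoeff g = c)
    (h : f ^ 2 * expand 2 two_ne_zero g = g ^ 2 * expand 2 two_ne_zero f) : f = g := by
  have hg0 : g ≠ 0 := by
    rintro rfl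
    exact hc (by simpa using hg.symm)
  have hge : expand 2 two_ne_zero g ≠ 0 := by
    intro h0
    refine hc ?_
    rw [← hg, ← constantCoeff_expand 2 two_ne_zero, h0, map_zero]
  have hgi : g * g⁻¹ = 1 := PowerSeries.mul_inv_cancel _ (by rwa [hg])
  have hgi' : expand 2 two_ne_zero g * expand 2 two_ne_zero g⁻¹ = 1 := by
    rw [← map_mul, hgi, map_one]
  have hr : f * g⁻¹ = 1 := by
    refine eq_one_of_sq_eq_expand_two h2 ?_ ?_
    · rw [map_mul, constantCoeff_inv, hf, hg, mul_inv_cancel₀ hc]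
    · rw [map_mul]
      refine mul_left_cancel₀ (mul_ne_zero (pow_ne_zero 2 hg0) hge) ?_
      linear_combination (g * g⁻¹ + 1) * f ^ 2 * expand 2 two_ne_zero g * hgi -
        expand 2 two_ne_zero f * g ^ 2 * hgi' + h
  linear_combination g * hr - f * hgi

lemma constantCoeff_pentagonalSeries : constantCoeff (pentagonalSeries K) = 1 := by
  rw [← coeff_zero_eq_constantCoeff_apply, ← qPoch_X_coeff K le_rfl]
  simp [qPoch]

theorem thetaSeries_pow_mul_eq_X_mul_pentagonalSeries_pow (h2 : (2 : K) ≠ 0) :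
    (thetaSeries (-1 : K)) ^ 8 * (thetaSeries 1) ^ 4 *
        ((thetaSeries 1) ^ 4 - (thetaSeries (-1)) ^ 4) =
      16 * X * (pentagonalSeries K * expand 2 two_ne_zero (pentagonalSeries K)) ^ 8 := by
  have h16 : (16 : K) ≠ 0 := by
    rw [show (16 : K) = 2 ^ 4 by norm_num]
    exact pow_ne_zero _ h2
  set e := expand (R := K) 2 two_ne_zero
  set f₁ := pentagonalSeries K
  have hf₁ : constantCoeff f₁ = 1 := constantCoeff_pentagonalSeries
  have hG : thetaSeries (-1 : K) * e f₁ = f₁ ^ 2 := thetaSeries_neg_one_mul_expand_pentagonalSeries K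
  have hG' : e (thetaSeries (-1 : K)) * e (e f₁) = e f₁ ^ 2 := by rw [← map_mul, hG, map_pow]
  have hM : thetaSeries (1 : K) * thetaSeries (-1) = e (thetaSeries (-1)) ^ 2 := by
    rw [thetaSeries_one_mul_thetaSeries_neg_one, map_pow]
  have hP : thetaSeries (1 : K) ^ 2 + thetaSeries (-1) ^ 2 = 2 * e (thetaSeries 1) ^ 2 := by
    rw [thetaSeries_one_sq_add_thetaSeries_neg_one_sq, map_pow]
  have hφ0 := constantCoeff_thetaSeries (1 : K)
  have hN0 := constantCoeff_thetaSeries (-1 : K)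
  have hφ1 := coeff_one_thetaSeries (1 : K)
  have hN1 := coeff_one_thetaSeries (-1 : K)
  set φ := thetaSeries (1 : K)
  set N := thetaSeries (-1 : K)
  have hk0 : X ∣ N ^ 8 * φ ^ 4 * (φ ^ 4 - N ^ 4) := by
    rw [X_dvd_iff]
    simp [hφ0, hN0]
  obtain ⟨k, hk⟩ := hk0
  have hk1 : constantCoeff k = 16 := by
    rw [← coeff_zero_eq_constantCoeff_apply, ← coeff_succ_X_mul, ← hk,
      show N ^ 8 * φ ^ 4 * (φ ^ 4 - N ^ 4) = N ^ 8 * φ ^ 4 * ((φ ^ 2) ^ 2 - (N ^ 2) ^ 2) by ring,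
      coeff_one_eq_of_mul_sq_sub_sq] <;> simp [hφ0, hN0, sq, coeff_one_mul, hφ1, hN1]
    norm_num
  have hF : constantCoeff (16 * (f₁ * e f₁) ^ 8) = 16 := by
    rw [map_mul, map_ofNat, map_pow, map_mul, constantCoeff_expand, hf₁]
    norm_num
  rw [hk, mul_right_comm, mul_comm _ X]
  congr 1
  refine eq_of_sq_mul_expand_two_eq h2 h16 hk1 hF ?_
  refine mul_left_cancel₀ (pow_ne_zero 4 (X_ne_zero (R := K))) ?_
  have hek := congrArg e hk
  simp only [map_mul, map_sub, map_pow, map_ofNat, e, expand_X] at hek ⊢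
  change e N ^ 8 * e φ ^ 4 * (e φ ^ 4 - e N ^ 4) = X ^ 2 * e k at hek
  change X ^ 4 * (k ^ 2 * (16 * (e f₁ * e (e f₁)) ^ 8)) = X ^ 4 * ((16 * (f₁ * e f₁) ^ 8) ^ 2 * e k)
  have hek' : 16 * (X ^ 2 * e k) = (φ * N) ^ 4 * (φ ^ 4 - N ^ 4) ^ 2 := by
    rw [← hek]
    calc _ = (e N ^ 2) ^ 4 * (2 * e φ ^ 2) ^ 2 * ((2 * e φ ^ 2) ^ 2 - 4 * (e N ^ 2) ^ 2) := by ring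
      _ = _ := by rw [← hP, ← hM]; ring
  have hprod : N ^ 12 * φ ^ 4 * (e (e f₁)) ^ 8 = f₁ ^ 16 * e f₁ ^ 8 := by
    calc _ = N ^ 8 * (φ * N) ^ 4 * (e (e f₁)) ^ 8 := by ring
      _ = N ^ 8 * (e N * e (e f₁)) ^ 8 := by rw [hM]; ring
      _ = (N * e f₁) ^ 8 * e f₁ ^ 8 := by rw [hG']; ring
      _ = _ := by rw [hG]; ring
  calc _ = X ^ 2 * ((X * k) ^ 2 * (16 * (e f₁ * e (e f₁)) ^ 8)) := by ring
    _ = X ^ 2 * (N ^ 12 * φ ^ 4 * (e (e f₁)) ^ 8) * e f₁ ^ 8 * 16 *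
        ((φ * N) ^ 4 * (φ ^ 4 - N ^ 4) ^ 2) := by rw [← hk]; ring
    _ = _ := by rw [hprod, ← hek']; ring

end product

section congruence

lemma coeff_mul_expand_eq_zero {R : Type*} [CommRing R] {m : ℕ} (hm : m ≠ 0) {f : R⟦X⟧}
    (hf : ∀ k, coeff (m * k) f = 0) (g : R⟦X⟧) (k : ℕ) :
    coeff (m * k) (f * expand m hm g) = 0 := by
  rw [coeff_mul]
  refine sum_eq_zero fun ij hij ↦ ?_
  rw [HasAntidiagonal.mem_antidiagonal] at hij
  rw [coeff_expand]
  split_ifs with h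
  · obtain ⟨l, hl⟩ := (Nat.dvd_add_left h).1 (hij ▸ dvd_mul_right m k)
    rw [hl, hf, zero_mul]
  · rw [mul_zero]

lemma ZMod.pow_eq_expand (p : ℕ) [Fact p.Prime] (f : (ZMod p)⟦X⟧) :
    f ^ p = expand p (Fact.out : p.Prime).ne_zero f := by
  have h := MvPowerSeries.map_frobenius_expand (σ := Unit) p (Fact.out : p.Prime).ne_zero (f := f)
  rw [ZMod.frobenius_zmod] at h
  exact h.symm.trans (congrFun (congrArg _ MvPowerSeries.map_id) _)

lemma ZMod.pow_prime_sq_eq_expand (p : ℕ) [Fact p.Prime] (hp : p ^ 2 ≠ 0) (f : (ZMod p)⟦X⟧) :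
    f ^ p ^ 2 = expand (p ^ 2) hp f := by
  simp only [sq, pow_mul, ZMod.pow_eq_expand]
  rw [expand_mul]

lemma map_eulerDerivation {R S : Type*} [CommRing R] [CommRing S] (φ : R →+* S) (f : R⟦X⟧) :
    map φ (eulerDerivation R f) = eulerDerivation S (map φ f) := by
  ext n
  simp [coeff_eulerDerivation]

lemma coeff_pow_mul_eulerDerivation_eq_zero (p : ℕ) [Fact p.Prime] {r m : ℕ}
    (h : ¬ p ^ r ∣ m + 1) (f : (ZMod p)⟦X⟧) (k : ℕ) :
    coeff (p ^ r * k) (f ^ m * eulerDerivation _ f) = 0 := by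
  obtain ⟨f, rfl⟩ := map_surjective (Int.castRingHom (ZMod p)) ZMod.intCast_surjective f
  rw [← map_eulerDerivation, ← map_pow, ← map_mul, coeff_map, eq_intCast,
    ZMod.intCast_zmod_eq_zero_iff_dvd]
  have h1 := coeff_eulerDerivation (p ^ r * k) (f ^ (m + 1))
  rw [Derivation.leibniz_pow, map_nsmul, Nat.add_sub_cancel, smul_eq_mul, nsmul_eq_mul,
    Nat.cast_mul, mul_assoc (↑(p ^ r) : ℤ)] at h1
  by_contra hc
  refine h ?_
  have hco : IsCoprime ((p ^ r : ℕ) : ℤ) (coeff (p ^ r * k) (f ^ m * eulerDerivation ℤ f)) := by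
    push_cast
    exact ((Nat.prime_iff_prime_int.1 Fact.out).coprime_iff_not_dvd.2 hc).pow_left
  exact_mod_cast hco.dvd_of_dvd_mul_right ⟨_, h1⟩

end congruence

section generatingFunction
open scoped PowerSeries.WithPiTopology
open Nat.Partition

lemma eq_one_of_hasProd_one {R : Type*} [CommRing R] [TopologicalSpace R] [T2Space R]
    [IsTopologicalSemiring R] {a b : ℕ → R⟦X⟧} {f g : R⟦X⟧}
    (ha : HasProd a f) (hb : HasProd b g) (h : ∀ i, a i * b i = 1) : f * g = 1 := by
  have := ha.mul hb
  simp only [h] at this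
  exact this.unique hasProd_one

variable (R : Type*) [CommRing R]

lemma tsum_X_pow_mul_one_sub [TopologicalSpace R] [T2Space R] [IsTopologicalRing R] (i : ℕ) :
    (∑' j, (X : R⟦X⟧) ^ ((i + 1) * j)) * (1 - X ^ (i + 1)) = 1 := by
  simp only [pow_mul]
  exact WithPiTopology.tsum_pow_mul_one_sub_of_constantCoeff_eq_zero (by simp)

theorem mk_card_partition_mul_pentagonalSeries :
    (mk fun n ↦ ((Fintype.card (Nat.Partition n) : ℕ) : R)) * pentagonalSeries R = 1 := by
  let _ : TopologicalSpace R := ⊥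
  have : DiscreteTopology R := ⟨rfl⟩
  have h := hasProd_powerSeriesMk_card_restricted R (fun _ ↦ True)
  simp only [if_true] at h
  convert eq_one_of_hasProd_one h (WithPiTopology.hasProd_one_sub_X_pow R)
    (tsum_X_pow_mul_one_sub R) using 4
  rw [restricted, filter_true_of_mem fun _ _ _ _ ↦ trivial]
  rfl

lemma hasProd_expand_two_pentagonalSeries [TopologicalSpace R] [IsTopologicalRing R] :
    HasProd (fun i ↦ if Even (i + 1) then 1 - (X : R⟦X⟧) ^ (i + 1) else 1)
      (expand 2 two_ne_zero (pentagonalSeries R)) := by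
  have hinj : Function.Injective fun i : ℕ ↦ 2 * i + 1 := fun a b h ↦ by simpa using h
  rw [← hinj.hasProd_iff]
  · have h := (WithPiTopology.hasProd_one_sub_X_pow R).map (expand 2 two_ne_zero) ?_
    · convert h using 1
      ext1 i
      rw [Function.comp_apply, Function.comp_apply, map_sub, map_one, map_pow, expand_X, ← pow_mul,
        if_pos ⟨i + 1, by ring⟩]
      congr 2
    · refine continuous_iff_continuousAt.2 fun f ↦ ?_
      rw [ContinuousAt, WithPiTopology.tendsto_iff_coeff_tendsto]
      intro d
      simp only [coeff_expand]
      split_ifs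
      · exact (WithPiTopology.continuous_coeff R _).tendsto f
      · exact tendsto_const_nhds
  · intro i hi
    rw [if_neg]
    rintro ⟨c, hc⟩
    exact hi ⟨c - 1, by simp; omega⟩

theorem mk_card_even_partition_mul_expand_pentagonalSeries :
    (mk fun n ↦ ((Fintype.card {μ : Nat.Partition n // ∀ i ∈ μ.parts, Even i} : ℕ) : R)) *
      expand 2 two_ne_zero (pentagonalSeries R) = 1 := by
  let _ : TopologicalSpace R := ⊥
  have : DiscreteTopology R := ⟨rfl⟩
  have h := hasProd_powerSeriesMk_card_restricted R Even
  convert eq_one_of_hasProd_one h (hasProd_expand_two_pentagonalSeries R) ?_ using 4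
  · rw [Fintype.card_subtype]
    rfl
  · intro i
    split_ifs
    · exact tsum_X_pow_mul_one_sub R i
    · exact one_mul 1

theorem mk_cubicPartition_mul :
    (mk fun n ↦ (cubicPartition n : R)) *
      (pentagonalSeries R * expand 2 two_ne_zero (pentagonalSeries R)) = 1 := by
  have h : (mk fun n ↦ (cubicPartition n : R)) =
      (mk fun n ↦ ((Fintype.card (Nat.Partition n) : ℕ) : R)) *
      mk fun n ↦ ((Fintype.card {μ : Nat.Partition n // ∀ i ∈ μ.parts, Even i} : ℕ) : R) := by
    ext n
    simp only [coeff_mul, coeff_mk, cubicPartition]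
    rw [Finset.Nat.sum_antidiagonal_eq_sum_range_succ
      (fun i j ↦ ((Fintype.card (Nat.Partition i) : ℕ) : R) *
        ((Fintype.card {μ : Nat.Partition j // ∀ i ∈ μ.parts, Even i} : ℕ) : R))]
    push_cast
    rfl
  rw [h, mul_mul_mul_comm, mk_card_partition_mul_pentagonalSeries,
    mk_card_even_partition_mul_expand_pentagonalSeries, one_mul]

end generatingFunction

section modSeven

instance : Fact (Nat.Prime 7) := ⟨by norm_num⟩

instance : CharP (ZMod 7)⟦X⟧ 7 := charP_of_injective_ringHom C_injective 7

lemma eq_of_wronskian_eq_of_derivative_eq_zero {R : Type*} [CommRing R] [CharP R 7]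
    {u w du dw : R} (hE : (u + w) * (u ^ 2 + u * w + w ^ 2) = -1)
    (hW : du * w - dw * u = u * w * (u - w))
    (hD : (3 * u ^ 2 + 4 * u * w + 2 * w ^ 2) * du + (2 * u ^ 2 + 4 * u * w + 3 * w ^ 2) * dw = 0) :
    2 * (2 * u - w) * (2 * du - dw) = 2 * (1 - ((2 * u - w) ^ 2) ^ 3) := by
  have h1 : 3 * dw = (3 * u ^ 2 + 4 * u * w + 2 * w ^ 2) * (u * w * (u - w)) := by
    linear_combination -w * hD + (3 * u ^ 2 + 4 * u * w + 2 * w ^ 2) * hW + 3 * dw * hE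
  have h2 : 3 * du = -(2 * u ^ 2 + 4 * u * w + 3 * w ^ 2) * (u * w * (u - w)) := by
    linear_combination -u * hD - (2 * u ^ 2 + 4 * u * w + 3 * w ^ 2) * hW + 3 * du * hE
  have h3 : 2 * (2 * u - w) * (u * w * (u - w)) * (-2 * (2 * u ^ 2 + 4 * u * w + 3 * w ^ 2) -
      (3 * u ^ 2 + 4 * u * w + 2 * w ^ 2)) =
      6 * (((u + w) * (u ^ 2 + u * w + w ^ 2)) ^ 2 - ((2 * u - w) ^ 2) ^ 3) := by
    clear * -
    grind
  rw [hE] at h3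
  have h7 : (7 : R) = 0 := CharP.cast_eq_zero R 7
  linear_combination 20 * (2 * u - w) * h2 - 10 * (2 * u - w) * h1 + 5 * h3 +
    (4 * (1 - ((2 * u - w) ^ 2) ^ 3) - 4 * (2 * u - w) * (2 * du - dw)) * h7

/-- The weight six form `(φ⁴(q) + φ⁴(-q)) (φ⁸(q) + φ⁴(q) φ⁴(-q) + φ⁸(-q))` is constant
modulo `7`. -/
lemma thetaSeries_hasse_invariant :
    (thetaSeries (1 : ZMod 7) ^ 4 + thetaSeries (-1) ^ 4) *
      ((thetaSeries 1 ^ 4) ^ 2 + thetaSeries 1 ^ 4 * thetaSeries (-1) ^ 4 +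
        (thetaSeries (-1) ^ 4) ^ 2) = -1 := by
  have hP := thetaSeries_one_sq_add_thetaSeries_neg_one_sq (R := ZMod 7)
  have hM := thetaSeries_one_mul_thetaSeries_neg_one (R := ZMod 7)
  have hφ0 := constantCoeff_thetaSeries (1 : ZMod 7)
  have hN0 := constantCoeff_thetaSeries (-1 : ZMod 7)
  rw [map_pow] at hP hM
  generalize thetaSeries (1 : ZMod 7) = φ at *
  generalize thetaSeries (-1 : ZMod 7) = N at *
  rw [eq_C_of_expand_two_eq (f := (φ ^ 4 + N ^ 4) * _)]
  · simp only [map_add, map_mul, map_pow, hφ0, hN0]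
    rw [map_one]
    linear_combination CharP.cast_eq_zero (ZMod 7)⟦X⟧ 7
  · simp only [map_add, map_mul, map_pow]
    generalize expand 2 two_ne_zero φ = p at *
    generalize expand 2 two_ne_zero N = m at *
    have hp : p ^ 2 = 4 * (φ ^ 2 + N ^ 2) := by
      have h7 : (7 : (ZMod 7)⟦X⟧) = 0 := CharP.cast_eq_zero _ 7
      linear_combination -4 * hP - p ^ 2 * h7
    have hp4 : p ^ 4 = (4 * (φ ^ 2 + N ^ 2)) ^ 2 := by rw [← hp]; ring
    have hm4 : m ^ 4 = φ ^ 2 * N ^ 2 := by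
      rw [show m ^ 4 = (m ^ 2) ^ 2 by ring, ← hM]
      ring
    rw [hp4, hm4]
    clear * -
    grind

/-- With `B = (2 φ⁴(q) - φ⁴(-q)) ^ 2` and `f = ∏ (1 - q ^ n) (1 - q ^ (2 n))`, modulo `7` both
`q dB/dq = 2 (1 - B ^ 3)` and `q f ^ 8 B = 2 (B ^ 3 - 1)` hold. -/
theorem exists_eulerDerivation_eq_mul :
    ∃ B : (ZMod 7)⟦X⟧, constantCoeff B = 1 ∧ eulerDerivation _ B = 2 * (1 - B ^ 3) ∧
      X * (pentagonalSeries _ * expand 2 two_ne_zero (pentagonalSeries _)) ^ 8 * B =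
        2 * (B ^ 3 - 1) := by
  have h2 : (2 : ZMod 7) ≠ 0 := by decide
  have hφ0 := constantCoeff_thetaSeries (1 : ZMod 7)
  have hN0 := constantCoeff_thetaSeries (-1 : ZMod 7)
  have hφ1 := coeff_one_thetaSeries (1 : ZMod 7)
  have hN1 := coeff_one_thetaSeries (-1 : ZMod 7)
  have hH := thetaSeries_hasse_invariant
  have hX := thetaSeries_pow_mul_eq_X_mul_pentagonalSeries_pow h2
  have hW := wronskian_eq_of_arithmetic_geometric_mean h2 (P := thetaSeries (1 : ZMod 7) ^ 2)
    (M := thetaSeries (-1) ^ 2) thetaSeries_one_sq_add_thetaSeries_neg_one_sq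
    (by rw [← mul_pow, thetaSeries_one_mul_thetaSeries_neg_one]) (by simp [hφ0]) (by simp [hN0])
    (by rw [sq, coeff_one_mul, hφ0, hφ1]; norm_num) (by rw [sq, coeff_one_mul, hN0, hN1]; norm_num)
  have hD := congrArg (eulerDerivation _) hH
  generalize pentagonalSeries (ZMod 7) * expand 2 two_ne_zero (pentagonalSeries _) = F at *
  generalize thetaSeries (1 : ZMod 7) = φ at *
  generalize thetaSeries (-1 : ZMod 7) = N at *
  have hD2 (f : (ZMod 7)⟦X⟧) :
      eulerDerivation _ (f ^ 2) = 2 * f * eulerDerivation _ f := by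
    rw [Derivation.leibniz_pow]
    simp only [smul_eq_mul, nsmul_eq_mul]
    norm_num [mul_assoc]
  set u := φ ^ 4 with hu
  set w := N ^ 4 with hw
  set du := eulerDerivation _ u with hdu
  set dw := eulerDerivation _ w with hdw
  have hW' : du * w - dw * u = u * w * (u - w) := by
    rw [hdu, hdw, hu, hw, show φ ^ 4 = (φ ^ 2) ^ 2 by ring, show N ^ 4 = (N ^ 2) ^ 2 by ring, hD2,
      hD2 (N ^ 2)]
    linear_combination φ ^ 2 * N ^ 2 * hW
  have hD' : (3 * u ^ 2 + 4 * u * w + 2 * w ^ 2) * du +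
      (2 * u ^ 2 + 4 * u * w + 3 * w ^ 2) * dw = 0 := by
    simp only [Derivation.leibniz, map_add, hD2, smul_eq_mul, map_neg, Derivation.map_one_eq_zero,
      neg_zero] at hD
    linear_combination hD
  refine ⟨(2 * u - w) ^ 2, ?_, ?_, ?_⟩
  · simp only [hu, hw, map_pow, map_sub, map_mul, map_ofNat, hφ0, hN0]
    norm_num
  · rw [← eq_of_wronskian_eq_of_derivative_eq_zero hH hW' hD', hD2, map_sub, two_mul u, map_add,
      ← two_mul, ← two_mul]
  · have h1 : N ^ 8 = w ^ 2 := by rw [hw]; ring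
    have h3 : w ^ 2 * u * (u - w) * (2 * u - w) ^ 2 =
        32 * (((2 * u - w) ^ 2) ^ 3 - ((u + w) * (u ^ 2 + u * w + w ^ 2)) ^ 2) := by
      generalize u = a
      generalize w = b
      clear * -
      grind
    rw [hH, ← h1, hX] at h3
    have h7 : (7 : (ZMod 7)⟦X⟧) = 0 := CharP.cast_eq_zero _ 7
    linear_combination 4 * h3 - 9 * (X * F ^ 8 * (2 * u - w) ^ 2 -
      2 * (((2 * u - w) ^ 2) ^ 3 - 1)) * h7

theorem seven_dvd_cubicPartition (n : ℕ) : 7 ∣ cubicPartition (49 * n + 43) := by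
  obtain ⟨B, hB0, hDB, hgB⟩ := exists_eulerDerivation_eq_mul
  have hG := mk_cubicPartition_mul (ZMod 7)
  set G : (ZMod 7)⟦X⟧ := mk fun n ↦ (cubicPartition n : ZMod 7) with hGdef
  generalize pentagonalSeries (ZMod 7) * expand 2 two_ne_zero (pentagonalSeries _) = F at *
  have hBB : B * B⁻¹ = 1 := PowerSeries.mul_inv_cancel _ (by simp [hB0])
  have hS (k : ℕ) : coeff (49 * k) ((X * F ^ 8) ^ 6 * B ^ 49) = 0 := by
    have h : (X * F ^ 8) ^ 6 * B ^ 49 = (-32 : ℤ) • (B ^ 58 * eulerDerivation _ B) +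
        (160 : ℤ) • (B ^ 55 * eulerDerivation _ B) + (-320 : ℤ) • (B ^ 52 * eulerDerivation _ B) +
        (320 : ℤ) • (B ^ 49 * eulerDerivation _ B) + (-160 : ℤ) • (B ^ 46 * eulerDerivation _ B) +
        (32 : ℤ) • (B ^ 43 * eulerDerivation _ B) := by
      rw [hDB]
      calc _ = (X * F ^ 8 * B) ^ 6 * B ^ 43 := by ring
        _ = _ := by
          rw [hgB]
          simp only [zsmul_eq_mul]
          push_cast
          ring
    have hz (m : ℕ) (hm : ¬ 7 ^ 2 ∣ m + 1) :
        coeff (49 * k) (B ^ m * eulerDerivation _ B) = 0 :=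
      coeff_pow_mul_eulerDerivation_eq_zero 7 hm B k
    simp only [h, map_add, map_zsmul]
    rw [hz, hz, hz, hz, hz, hz] <;> norm_num
  have hXG : X ^ 6 * G = (X * F ^ 8) ^ 6 * B ^ 49 * (B⁻¹ * G) ^ 7 ^ 2 := by
    calc X ^ 6 * G = X ^ 6 * G * (G * F) ^ 48 * (B * B⁻¹) ^ 49 := by rw [hG, hBB]; ring
      _ = _ := by ring
  have h := coeff_mul_expand_eq_zero (show 7 ^ 2 ≠ 0 by norm_num) hS (B⁻¹ * G) (n + 1)
  rw [← ZMod.pow_prime_sq_eq_expand, ← hXG, show 7 ^ 2 * (n + 1) = 49 * n + 43 + 6 by ring,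
    coeff_X_pow_mul, hGdef, coeff_mk] at h
  exact (ZMod.natCast_eq_zero_iff _ 7).1 h

end modSeven

end cubicPartition

theorem cubicPartition_mod_seven_43 (n : ℕ) : 7 ∣ cubicPartition (49 * n + 43) :=
  seven_dvd_cubicPartition n
end

section
/- Let a(n) be the cubic partition function. Then for every nonnegative integer n, a(n) + ∑_{k ≥ 1, k+k² ≤ n} a(n - k - k²) ≡ Δ(n) (mod 2), where Δ(n) = 1 if n = s(s+1)/2 for some nonnegative integer s, and Δ(n) = 0 otherwise. -/
open Classical in
/-- Δ(n) = 1 if n is a triangular number s(s+1)/2, and 0 otherwise. -/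
noncomputable def triangularIndicator (n : ℕ) : ℕ :=
  if ∃ s : ℕ, 2 * n = s * (s + 1) then 1 else 0

section FiniteIdentity

open Finset

variable {R : Type*} [CommRing R]

/-- A finite form of Gauss's identity for the sum of `x ^ (s * (s + 1) / 2)`, due to Shanks. -/
theorem prod_one_sub_odd_mul_sum_pow_triangular (x : R) (n : ℕ) :
    (∏ i ∈ range n, (1 - x ^ (2 * i + 1))) * ∑ s ∈ range (2 * n), x ^ (s * (s + 1) / 2) =
      ∑ s ∈ range n, (∏ i ∈ Ico s n, (1 - x ^ (2 * i + 2))) *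
        (∏ i ∈ range s, (1 - x ^ (2 * i + 1))) * x ^ (s * (2 * n + 1)) := by
  induction n with
  | zero => simp
  | succ n ih =>
    set G : ℕ → R := fun s ↦ (∏ i ∈ Ico s n, (1 - x ^ (2 * i + 2))) *
        (∏ i ∈ range s, (1 - x ^ (2 * i + 1))) * (1 - x ^ (2 * s)) * x ^ (s * (2 * n + 1)) with hG
    have key : ∀ s ∈ range n, (∏ i ∈ Ico s (n + 1), (1 - x ^ (2 * i + 2))) *
        (∏ i ∈ range s, (1 - x ^ (2 * i + 1))) * x ^ (s * (2 * (n + 1) + 1)) =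
        (1 - x ^ (2 * n + 1)) * ((∏ i ∈ Ico s n, (1 - x ^ (2 * i + 2))) *
        (∏ i ∈ range s, (1 - x ^ (2 * i + 1))) * x ^ (s * (2 * n + 1))) + (G (s + 1) - G s) := by
      intro s hs
      have hs := mem_range.mp hs
      simp only [hG]
      rw [prod_Ico_succ_top hs.le, prod_eq_prod_Ico_succ_bot hs, prod_range_succ]
      ring
    have h1 : 2 * n * (2 * n + 1) / 2 = n * (2 * n + 1) := by
      rw [mul_assoc, Nat.mul_div_cancel_left _ two_pos]
    have h2 : (2 * n + 1) * (2 * n + 1 + 1) / 2 = (2 * n + 1) * (n + 1) := by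
      rw [show (2 * n + 1) * (2 * n + 1 + 1) = 2 * ((2 * n + 1) * (n + 1)) by ring,
        Nat.mul_div_cancel_left _ two_pos]
    have h3 : 2 * (n + 1) = 2 * n + 1 + 1 := by ring
    rw [sum_range_succ _ n, sum_congr rfl key, sum_add_distrib, sum_range_sub, ← mul_sum, ← ih,
      h3, sum_range_succ, sum_range_succ, h1, h2, prod_range_succ]
    simp only [hG, Ico_self, Nat.Ico_succ_singleton, prod_empty, prod_singleton]
    ring

end FiniteIdentity

namespace PowerSeries

open Finset Filter Topology
open scoped PowerSeries.WithPiTopology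

section

variable (R : Type*) [CommRing R]

/-- The power series `∑ X ^ (s * (s + 1) / 2)`. -/
noncomputable def triangularSeries : R⟦X⟧ := mk fun n ↦ (triangularIndicator n : R)

@[simp]
theorem coeff_triangularSeries (n : ℕ) : coeff n (triangularSeries R) = triangularIndicator n :=
  coeff_mk _ _

theorem coeff_sum_X_pow_triangular {d m : ℕ} (h : d < m) :
    coeff d (∑ s ∈ range m, (X : R⟦X⟧) ^ (s * (s + 1) / 2)) = triangularIndicator d := by
  have hT (s : ℕ) : d = s * (s + 1) / 2 ↔ 2 * d = s * (s + 1) := by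
    have := (Nat.even_mul_succ_self s).two_dvd
    lia
  simp only [map_sum, coeff_X_pow, hT, triangularIndicator]
  split_ifs with hs
  · obtain ⟨s, hs⟩ := hs
    rw [sum_eq_single s]
    · simp [hs]
    · intro t _ hts
      rw [if_neg]
      intro ht
      apply hts
      rw [hs] at ht
      rcases lt_trichotomy s t with h | h | h
      · nlinarith
      · exact h.symm
      · nlinarith
    · intro hsm
      rw [mem_range] at hsm
      nlinarith
  · push Not at hs
    simp [hs]

variable [TopologicalSpace R]

theorem tendsto_sum_X_pow_triangular :
    Tendsto (fun n ↦ ∑ s ∈ range (2 * n), (X : R⟦X⟧) ^ (s * (s + 1) / 2)) atTop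
      (𝓝 (triangularSeries R)) := by
  rw [WithPiTopology.tendsto_iff_coeff_tendsto]
  refine fun d ↦ tendsto_atTop_of_eventually_const (i₀ := d + 1) fun n hn ↦ ?_
  rw [coeff_sum_X_pow_triangular R (by lia), coeff_triangularSeries]

theorem multipliable_one_sub_X_pow_two_mul_add (b : ℕ) :
    Multipliable fun n ↦ (1 : R⟦X⟧) - X ^ (2 * n + b) := by
  nontriviality R using Subsingleton.elim (α := R⟦X⟧)
  simp_rw [sub_eq_add_neg]
  apply WithPiTopology.multipliable_one_add_of_tendsto_order_atTop_nhds_top R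
  simp_rw [order_neg, order_X_pow]
  exact ENat.tendsto_natCast_nhds_top.comp
    (tendsto_atTop_mono (fun n ↦ by dsimp only [id]; lia) tendsto_id)

variable [T2Space R] [IsTopologicalRing R]

/-- **Gauss's identity** for the generating function of the triangular numbers. -/
theorem tprod_odd_mul_triangularSeries :
    (∏' n, (1 - X ^ (2 * n + 1) : R⟦X⟧)) * triangularSeries R =
      ∏' n, (1 - X ^ (2 * n + 2) : R⟦X⟧) := by
  have hl := (multipliable_one_sub_X_pow_two_mul_add R 1).hasProd.tendsto_prod_nat.mul
    (tendsto_sum_X_pow_triangular R)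
  have hr := (multipliable_one_sub_X_pow_two_mul_add R 2).hasProd.tendsto_prod_nat
  refine tendsto_nhds_unique hl ?_
  rw [WithPiTopology.tendsto_iff_coeff_tendsto] at hr ⊢
  refine fun d ↦ (hr d).congr' ?_
  filter_upwards [eventually_gt_atTop d] with n hn
  rw [prod_one_sub_odd_mul_sum_pow_triangular, map_sum, sum_eq_single 0]
  · simp
  · intro s _ hs
    have := Nat.pos_of_ne_zero hs
    rw [coeff_mul_X_pow', if_neg (by nlinarith)]
  · intro h
    exact absurd (mem_range.mpr (by lia)) h

theorem tprod_odd_mul_tprod_even :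
    (∏' n, (1 - X ^ (2 * n + 1) : R⟦X⟧)) * ∏' n, (1 - X ^ (2 * n + 2) : R⟦X⟧) =
      ∏' n, (1 - X ^ (n + 1) : R⟦X⟧) :=
  tprod_even_mul_odd (f := fun n ↦ (1 - X ^ (n + 1) : R⟦X⟧))
    (multipliable_one_sub_X_pow_two_mul_add R 1) (multipliable_one_sub_X_pow_two_mul_add R 2)

theorem mk_card_restricted_mul_of_hasProd (p : ℕ → Prop) [DecidablePred p] {f : R⟦X⟧}
    (hf : HasProd (fun i ↦ if p (i + 1) then (1 : R⟦X⟧) - X ^ (i + 1) else 1) f) :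
    (mk fun n ↦ (#(Nat.Partition.restricted n p) : R)) * f = 1 := by
  refine ((Nat.Partition.hasProd_powerSeriesMk_card_restricted R p).mul hf).unique ?_
  convert hasProd_one with i
  split_ifs
  · simp_rw [pow_mul]
    rw [WithPiTopology.tsum_pow_mul_one_sub_of_constantCoeff_eq_zero (by simp)]
  · simp

theorem mk_card_partition_mul_tprod :
    (mk fun n ↦ (Fintype.card (Nat.Partition n) : R)) * ∏' n, (1 - X ^ (n + 1) : R⟦X⟧) = 1 := by
  have h := mk_card_restricted_mul_of_hasProd R (fun _ ↦ True)
    (f := ∏' n, (1 - X ^ (n + 1) : R⟦X⟧))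
    (by simpa using (WithPiTopology.hasProd_one_sub_X_pow R).multipliable.hasProd)
  simpa [Nat.Partition.restricted] using h

theorem mk_card_even_partition_mul_tprod :
    (mk fun n ↦ (Fintype.card {μ : Nat.Partition n // ∀ i ∈ μ.parts, Even i} : R)) *
      ∏' n, (1 - X ^ (2 * n + 2) : R⟦X⟧) = 1 := by
  have h := mk_card_restricted_mul_of_hasProd R Even
    (f := 1 * ∏' n, (1 - X ^ (2 * n + 2) : R⟦X⟧)) (HasProd.even_mul_odd
      (by simp [hasProd_one])
      (by simpa [Nat.even_add_one] using (multipliable_one_sub_X_pow_two_mul_add R 2).hasProd))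
  simpa [Nat.Partition.restricted, Fintype.card_subtype] using h

theorem tprod_even_eq_sq [CharP R 2] :
    ∏' n, (1 - X ^ (2 * n + 2) : R⟦X⟧) = (∏' n, (1 - X ^ (n + 1) : R⟦X⟧)) ^ 2 := by
  have : CharP R⟦X⟧ 2 := charP_of_injective_ringHom (C_injective (R := R)) 2
  have h := (WithPiTopology.hasProd_one_sub_X_pow R).multipliable
  rw [sq, ← h.tprod_mul h]
  refine tprod_congr fun n ↦ ?_
  rw [← sq, sub_pow_char, one_pow, ← pow_mul]
  ring_nf

end

theorem mk_cubicPartition_eq (R : Type*) [CommRing R] :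
    (mk fun n ↦ (cubicPartition n : R)) = (mk fun n ↦ (Fintype.card (Nat.Partition n) : R)) *
      mk fun n ↦ (Fintype.card {μ : Nat.Partition n // ∀ i ∈ μ.parts, Even i} : R) := by
  ext n
  rw [coeff_mul, Nat.sum_antidiagonal_eq_sum_range_succ_mk]
  simp [cubicPartition]

theorem mk_cubicPartition_mul_triangularSeries_sq :
    (mk fun n ↦ (cubicPartition n : ZMod 2)) * triangularSeries (ZMod 2) ^ 2 =
      triangularSeries (ZMod 2) := by
  let _ : TopologicalSpace (ZMod 2) := ⊥
  have _ : DiscreteTopology (ZMod 2) := ⟨rfl⟩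
  have h1 := mk_card_partition_mul_tprod (ZMod 2)
  have h2 := mk_card_even_partition_mul_tprod (ZMod 2)
  have h3 := tprod_odd_mul_tprod_even (ZMod 2)
  have h4 := tprod_odd_mul_triangularSeries (ZMod 2)
  rw [mk_cubicPartition_eq]
  rw [tprod_even_eq_sq] at h2 h3 h4
  generalize (∏' n, (1 - X ^ (n + 1) : (ZMod 2)⟦X⟧)) = E at *
  generalize (∏' n, (1 - X ^ (2 * n + 1) : (ZMod 2)⟦X⟧)) = O at *
  generalize (mk fun n ↦ (Fintype.card (Nat.Partition n) : ZMod 2)) = P at *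
  generalize (mk fun n ↦
    (Fintype.card {μ : Nat.Partition n // ∀ i ∈ μ.parts, Even i} : ZMod 2)) = Q at *
  generalize triangularSeries (ZMod 2) = T at *
  have hOE : O * E = 1 := by linear_combination P * h3 + (1 - O * E) * h1
  have hT : T = E ^ 3 := by linear_combination E * h4 - T * hOE
  rw [hT]
  linear_combination E ^ 3 * (Q * E ^ 2) * h1 + E ^ 3 * h2

theorem coeff_triangularSeries_sq (n : ℕ) [Decidable (∃ k : ℕ, n = k + k ^ 2)] :
    coeff n (triangularSeries (ZMod 2) ^ 2) = if ∃ k : ℕ, n = k + k ^ 2 then 1 else 0 := by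
  have h : triangularSeries (ZMod 2) ^ 2 =
      (triangularSeries (ZMod 2)).expand 2 two_ne_zero := by
    have := MvPowerSeries.map_frobenius_expand (R := ZMod 2) 2 two_ne_zero
      (f := triangularSeries (ZMod 2))
    rw [ZMod.frobenius_zmod] at this
    rw [← this, MvPowerSeries.map_id]
    rfl
  rw [h, coeff_expand, coeff_triangularSeries, triangularIndicator]
  by_cases hn : 2 ∣ n
  · have hiff : (∃ s : ℕ, 2 * (n / 2) = s * (s + 1)) ↔ ∃ k : ℕ, n = k + k ^ 2 :=
      exists_congr fun k ↦ by rw [Nat.mul_div_cancel' hn, mul_add_one, sq, add_comm]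
    by_cases hk : ∃ k : ℕ, n = k + k ^ 2
    · rw [if_pos hn, if_pos (hiff.mpr hk), if_pos hk, Nat.cast_one]
    · rw [if_pos hn, if_neg (mt hiff.mp hk), if_neg hk, Nat.cast_zero]
  · rw [if_neg hn, if_neg]
    rintro ⟨k, rfl⟩
    exact hn ((by ring : k * (k + 1) = k + k ^ 2) ▸ (Nat.even_mul_succ_self k).two_dvd)

end PowerSeries

theorem cubicPartition_parity_recurrence (n : ℕ) :
    (cubicPartition n +
      ∑ k ∈ (Finset.range (n + 1)).filter (fun k => 1 ≤ k ∧ k + k ^ 2 ≤ n),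
        cubicPartition (n - k - k ^ 2)) % 2 = triangularIndicator n % 2 := by
  classical
  have hsum : cubicPartition n +
      ∑ k ∈ (Finset.range (n + 1)).filter (fun k => 1 ≤ k ∧ k + k ^ 2 ≤ n),
        cubicPartition (n - k - k ^ 2) =
      ∑ k ∈ (Finset.range (n + 1)).filter (fun k => k + k ^ 2 ≤ n),
        cubicPartition (n - (k + k ^ 2)) := by
    rw [← Finset.add_sum_erase _ _ (show 0 ∈ (Finset.range (n + 1)).filter
      (fun k => k + k ^ 2 ≤ n) by simp)]
    refine congrArg₂ (· + ·) (by simp) (Finset.sum_congr ?_ fun k _ ↦ by rw [Nat.sub_sub])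
    ext k
    simp only [Finset.mem_filter, Finset.mem_erase, Finset.mem_range]
    grind
  have himage : (Finset.range (n + 1)).filter (fun i ↦ ∃ k : ℕ, i = k + k ^ 2) =
      ((Finset.range (n + 1)).filter (fun k => k + k ^ 2 ≤ n)).image fun k ↦ k + k ^ 2 := by
    ext i
    simp only [Finset.mem_filter, Finset.mem_image, Finset.mem_range]
    constructor
    · rintro ⟨hi, k, rfl⟩
      exact ⟨k, ⟨by lia, by lia⟩, rfl⟩
    · rintro ⟨k, ⟨_, hk⟩, rfl⟩
      exact ⟨by lia, k, rfl⟩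
  have h := congrArg (PowerSeries.coeff n) PowerSeries.mk_cubicPartition_mul_triangularSeries_sq
  rw [mul_comm, PowerSeries.coeff_mul, Finset.Nat.sum_antidiagonal_eq_sum_range_succ_mk] at h
  simp only [PowerSeries.coeff_triangularSeries_sq, PowerSeries.coeff_mk, ite_mul, one_mul,
    zero_mul, PowerSeries.coeff_triangularSeries] at h
  rw [← Finset.sum_filter, himage, Finset.sum_image] at h
  · rw [hsum]
    refine (ZMod.natCast_eq_natCast_iff _ _ 2).mp ?_
    exact_mod_cast h
  · intro a _ b _ hab
    have hab : a + a ^ 2 = b + b ^ 2 := hab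
    rcases lt_trichotomy a b with h | h | h
    · nlinarith
    · exact h
    · nlinarith
end

section
/- Let a(n) be the cubic partition function. There are infinitely many nonnegative integers n such that a(n) is even. -/
/-- Partitions of `n` containing `d` at least `j` times correspond to partitions of `n - d * j`. -/
theorem card_filter_le_count {n d j : ℕ} (hd : 0 < d) (h : d * j ≤ n) :
    (Finset.univ.filter fun l : Nat.Partition n ↦ j ≤ l.parts.count d).card =
      Fintype.card (Nat.Partition (n - d * j)) := by
  rw [← Finset.card_univ]
  refine Finset.card_bij' (fun l hl ↦ ⟨l.parts - Multiset.replicate j d, ?_, ?_⟩)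
    (fun m _ ↦ ⟨m.parts + Multiset.replicate j d, ?_, ?_⟩) ?_ ?_ ?_ ?_
  · intro i hi
    exact l.parts_pos (Multiset.mem_of_le tsub_le_self hi)
  · have hl' := Multiset.le_count_iff_replicate_le.1 (Finset.mem_filter.1 hl).2
    have := congrArg Multiset.sum (tsub_add_cancel_of_le hl')
    rw [Multiset.sum_add, l.parts_sum, Multiset.sum_replicate, smul_eq_mul, mul_comm] at this
    omega
  · intro i hi
    rcases Multiset.mem_add.1 hi with hi | hi
    · exact m.parts_pos hi
    · rwa [Multiset.eq_of_mem_replicate hi]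
  · rw [Multiset.sum_add, m.parts_sum, Multiset.sum_replicate, smul_eq_mul, mul_comm j]
    omega
  · simp
  · simp
  · intro l hl
    ext1
    exact tsub_add_cancel_of_le (Multiset.le_count_iff_replicate_le.1 (Finset.mem_filter.1 hl).2)
  · intro m _
    ext1
    simp

theorem Nat.Partition.sum_count_mul {n : ℕ} (l : Nat.Partition n) :
    ∑ d ∈ Finset.Icc 1 n, l.parts.count d * d = n := by
  conv_rhs => rw [← l.parts_sum]
  rw [Finset.sum_multiset_count_of_subset l.parts (Finset.Icc 1 n)]
  · simp
  · intro d hd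
    rw [Multiset.mem_toFinset] at hd
    exact Finset.mem_Icc.2 ⟨l.parts_pos hd, l.le_of_mem_parts hd⟩

open ArithmeticFunction in
theorem Nat.Partition.mul_card_eq_sum_sigma (n : ℕ) :
    n * Fintype.card (Nat.Partition n) =
      ∑ k ∈ Finset.Icc 1 n, sigma 1 k * Fintype.card (Nat.Partition (n - k)) := by
  have hcount (l : Nat.Partition n) (d : ℕ) (hd : d ∈ Finset.Icc 1 n) :
      l.parts.count d * d = ∑ j ∈ Finset.Icc 1 n, if j ≤ l.parts.count d then d else 0 := by
    rw [← Finset.sum_filter, Finset.sum_const, smul_eq_mul]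
    congr 1
    have hle : l.parts.count d * d ≤ n := by
      conv_rhs => rw [← l.sum_count_mul]
      exact Finset.single_le_sum (f := fun d ↦ l.parts.count d * d) (by simp) hd
    have : (Finset.Icc 1 n).filter (· ≤ l.parts.count d) = Finset.Icc 1 (l.parts.count d) := by
      ext j
      have := Nat.le_mul_of_pos_right (l.parts.count d) (Finset.mem_Icc.1 hd).1
      simp only [Finset.mem_filter, Finset.mem_Icc]
      omega
    rw [this, Nat.card_Icc, Nat.add_sub_cancel]
  have hzero (d j : ℕ) (h : ¬ d * j ≤ n) (hd : d ∈ Finset.Icc 1 n) :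
      (Finset.univ.filter fun l : Nat.Partition n ↦ j ≤ l.parts.count d) = ∅ := by
    refine Finset.filter_eq_empty_iff.2 fun l _ hj ↦ h ?_
    calc d * j ≤ l.parts.count d * d := by rw [mul_comm]; gcongr
      _ ≤ ∑ d ∈ Finset.Icc 1 n, l.parts.count d * d :=
        Finset.single_le_sum (f := fun d ↦ l.parts.count d * d) (by simp) hd
      _ = n := l.sum_count_mul
  calc n * Fintype.card (Nat.Partition n)
      = ∑ l : Nat.Partition n, ∑ d ∈ Finset.Icc 1 n, ∑ j ∈ Finset.Icc 1 n,
          if j ≤ l.parts.count d then d else 0 := by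
        rw [Finset.sum_congr rfl fun l _ ↦
          (Finset.sum_congr rfl (hcount l)).symm.trans l.sum_count_mul]
        simp [mul_comm]
    _ = ∑ x ∈ Finset.Icc 1 n ×ˢ Finset.Icc 1 n,
          if x.1 * x.2 ≤ n then x.1 * Fintype.card (Nat.Partition (n - x.1 * x.2)) else 0 := by
        rw [Finset.sum_product, Finset.sum_comm]
        refine Finset.sum_congr rfl fun d hd ↦ ?_
        rw [Finset.sum_comm]
        refine Finset.sum_congr rfl fun j _ ↦ ?_
        rw [← Finset.sum_filter, Finset.sum_const, smul_eq_mul, mul_comm]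
        split_ifs with h
        · rw [card_filter_le_count (Finset.mem_Icc.1 hd).1 h]
        · rw [hzero d j h hd, Finset.card_empty, mul_zero]
    _ = ∑ k ∈ Finset.Icc 1 n, sigma 1 k * Fintype.card (Nat.Partition (n - k)) := by
        rw [← Finset.sum_filter,
          ← Finset.sum_fiberwise_of_maps_to (g := fun x : ℕ × ℕ ↦ x.1 * x.2) (t := Finset.Icc 1 n)]
        · refine Finset.sum_congr rfl fun k hk ↦ ?_
          rw [Finset.mem_Icc] at hk
          rw [sigma_one_apply, ← Nat.sum_divisorsAntidiagonal (fun d _ ↦ d), Finset.sum_mul]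
          refine Finset.sum_congr ?_ fun x hx ↦ ?_
          · ext ⟨d, j⟩
            simp only [Finset.mem_filter, Finset.mem_product, Finset.mem_Icc,
              Nat.mem_divisorsAntidiagonal]
            constructor
            · rintro ⟨-, h⟩
              exact ⟨h, by omega⟩
            · rintro ⟨rfl, h⟩
              have hd : 0 < d := Nat.pos_of_ne_zero fun h' ↦ h (by simp [h'])
              have hj : 0 < j := Nat.pos_of_ne_zero fun h' ↦ h (by simp [h'])
              have := Nat.le_mul_of_pos_right d hj
              have := Nat.le_mul_of_pos_left j hd
              omega
          · rw [(Nat.mem_divisorsAntidiagonal.1 hx).1]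
        · intro x hx
          simp only [Finset.mem_filter, Finset.mem_product, Finset.mem_Icc] at hx ⊢
          exact ⟨Nat.mul_pos hx.1.1.1 hx.1.2.1, hx.2⟩

open ArithmeticFunction in
theorem even_sigma_one_of_modEq {p k : ℕ} (hp : p.Prime) (hodd : p ≠ 2)
    (h : k ≡ p [MOD p ^ 2]) : Even (sigma 1 k) := by
  obtain ⟨m, rfl⟩ : p ∣ k := (h.dvd_iff (dvd_pow_self p two_ne_zero)).2 dvd_rfl
  have hcop : p.Coprime m := by
    refine hp.coprime_iff_not_dvd.2 fun hm ↦ ?_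
    have : p ^ 2 ∣ p := (h.dvd_iff dvd_rfl).1 (by rw [sq]; exact Nat.mul_dvd_mul_left p hm)
    have := Nat.le_of_dvd hp.pos this
    nlinarith [hp.two_le]
  rw [isMultiplicative_sigma.map_mul_of_coprime hcop, sigma_one_apply p, hp.sum_divisors]
  exact ((hp.odd_of_ne_two hodd).add_one).mul_right _

open ArithmeticFunction in
theorem exists_forall_even_sigma_one (N : ℕ) : ∃ x, 0 < x ∧ ∀ i ≤ N, Even (sigma 1 (x + i)) := by
  set p : ℕ → ℕ := fun i ↦ Nat.nth Nat.Prime (i + 1) with hp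
  have hinj : Function.Injective p := fun i j h ↦
    Nat.succ_injective (Nat.nth_injective Nat.infinite_setOfPred_prime h)
  have hprime (i : ℕ) : (p i).Prime := Nat.prime_nth_prime _
  have htwo (i : ℕ) : p i ≠ 2 := by
    rw [← Nat.nth_prime_zero_eq_two]
    exact fun h ↦ Nat.succ_ne_zero i (Nat.nth_injective Nat.infinite_setOfPred_prime h)
  obtain ⟨x, hx⟩ := Nat.chineseRemainderOfFinset (fun i ↦ p i + i * (p i ^ 2 - 1))
    (fun i ↦ p i ^ 2) (Finset.range (N + 1)) (fun i _ ↦ pow_ne_zero 2 (hprime i).ne_zero)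
    (fun i _ j _ hij ↦ Nat.Coprime.pow 2 2
      ((Nat.coprime_primes (hprime i) (hprime j)).2 (hinj.ne hij)))
  have hmod (i : ℕ) (hi : i ≤ N) : x + i ≡ p i [MOD p i ^ 2] := by
    have h := (hx i (Finset.mem_range.2 (by omega))).add_right i
    have heq : p i + i * (p i ^ 2 - 1) + i = p i + i * p i ^ 2 := by
      have : 1 ≤ p i ^ 2 := Nat.one_le_pow _ _ (hprime i).pos
      obtain ⟨c, hc⟩ := Nat.exists_eq_add_of_le this
      rw [hc, Nat.add_sub_cancel_left]
      ring
    rw [heq] at h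
    exact h.trans (by simp [Nat.ModEq])
  refine ⟨x, Nat.pos_of_ne_zero ?_, fun i hi ↦
    even_sigma_one_of_modEq (hprime i) (htwo i) (hmod i hi)⟩
  rintro rfl
  have : p 0 ^ 2 ∣ p 0 := (Nat.modEq_zero_iff_dvd).1 (hmod 0 N.zero_le).symm
  have := Nat.le_of_dvd (hprime 0).pos this
  nlinarith [(hprime 0).two_le]

open ArithmeticFunction in
theorem Nat.Partition.mul_card_eq_sum_antidiagonal (n : ℕ) :
    n * Fintype.card (Nat.Partition n) =
      ∑ x ∈ Finset.HasAntidiagonal.antidiagonal n, sigma 1 x.1 * Fintype.card (Nat.Partition x.2) := by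
  rw [mul_card_eq_sum_sigma, Finset.Nat.sum_antidiagonal_eq_sum_range_succ
    fun i j ↦ sigma 1 i * Fintype.card (Nat.Partition j)]
  refine Finset.sum_subset (fun k hk ↦ ?_) fun k hk hk' ↦ ?_
  · simp only [Finset.mem_Icc, Finset.mem_range] at hk ⊢
    omega
  · obtain rfl : k = 0 := by
      simp only [Finset.mem_Icc, Finset.mem_range] at hk hk'
      omega
    simp

theorem Nat.Partition.even_of_forall_even {n : ℕ} (l : Nat.Partition n)
    (h : ∀ i ∈ l.parts, Even i) : Even n := by
  rw [even_iff_two_dvd, ← l.parts_sum]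
  exact Multiset.dvd_sum fun i hi ↦ (h i hi).two_dvd

open ArithmeticFunction PowerSeries in
theorem mul_cubicPartition_eq_sum_antidiagonal (n : ℕ) :
    (n * cubicPartition n : ZMod 2) =
      ∑ x ∈ Finset.HasAntidiagonal.antidiagonal n, (sigma 1 x.1 : ZMod 2) * cubicPartition x.2 := by
  set e : ℕ → ℕ := fun m ↦ Fintype.card {μ : Nat.Partition m // ∀ i ∈ μ.parts, Even i} with he
  set P : (ZMod 2)⟦X⟧ := mk fun m ↦ (Fintype.card (Nat.Partition m) : ZMod 2) with hP
  set E : (ZMod 2)⟦X⟧ := mk fun m ↦ (e m : ZMod 2) with hE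
  set S : (ZMod 2)⟦X⟧ := mk fun m ↦ (sigma 1 m : ZMod 2) with hS
  have hcubic : (mk fun m ↦ (cubicPartition m : ZMod 2)) = P * E := by
    ext m
    rw [coeff_mul, coeff_mk, cubicPartition, Finset.Nat.sum_antidiagonal_eq_sum_range_succ
      fun i j ↦ coeff i P * coeff j E]
    simp [hP, hE, he]
  have hpart : (mk fun m ↦ (m * Fintype.card (Nat.Partition m) : ZMod 2)) = S * P := by
    ext m
    rw [coeff_mul, coeff_mk]
    simp only [hS, hP, coeff_mk]
    exact_mod_cast congrArg (Nat.cast : ℕ → ZMod 2) (Nat.Partition.mul_card_eq_sum_antidiagonal m)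
  have heven (m : ℕ) : (m * e m : ZMod 2) = 0 := by
    rcases Nat.even_or_odd m with hm | hm
    · rw [(ZMod.natCast_eq_zero_iff_even).2 hm, zero_mul]
    · have : IsEmpty {μ : Nat.Partition m // ∀ i ∈ μ.parts, Even i} :=
        ⟨fun μ ↦ Nat.not_even_iff_odd.2 hm (μ.1.even_of_forall_even μ.2)⟩
      simp [he]
  calc (n * cubicPartition n : ZMod 2)
      = n * coeff n (P * E) := by rw [← hcubic, coeff_mk]
    _ = coeff n ((mk fun m ↦ (m * Fintype.card (Nat.Partition m) : ZMod 2)) * E) := by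
        rw [coeff_mul, coeff_mul, Finset.mul_sum]
        refine Finset.sum_congr rfl fun x hx ↦ ?_
        rw [← Finset.HasAntidiagonal.mem_antidiagonal.1 hx]
        simp only [hP, hE, coeff_mk]
        push_cast
        linear_combination (Fintype.card (Nat.Partition x.1) : ZMod 2) * heven x.2
    _ = ∑ x ∈ Finset.HasAntidiagonal.antidiagonal n, (sigma 1 x.1 : ZMod 2) * cubicPartition x.2 := by
        rw [hpart, mul_assoc, ← hcubic, coeff_mul]
        simp [hS]

open ArithmeticFunction in
theorem cubicPartition_infinitely_even : ∀ N : ℕ, ∃ n : ℕ, N ≤ n ∧ Even (cubicPartition n) := by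
  intro N
  by_contra! hodd
  have hone (m : ℕ) : (cubicPartition (N + m) : ZMod 2) = 1 :=
    ZMod.natCast_eq_one_iff_odd.2 (Nat.not_even_iff_odd.1 (hodd _ (Nat.le_add_right N m)))
  obtain ⟨x, hx, hsigma⟩ := exists_forall_even_sigma_one N
  obtain ⟨y, rfl⟩ := Nat.exists_eq_add_of_le' hx
  have hzero (i : ℕ) (hi : i ≤ N) : (sigma 1 (y + 1 + i) : ZMod 2) = 0 :=
    ZMod.natCast_eq_zero_iff_even.2 (hsigma i hi)
  have hsum (z : ℕ) (hz : ∀ j < N, (sigma 1 (N + z - j) : ZMod 2) = 0) :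
      ((N + z : ℕ) : ZMod 2) = ∑ i ∈ Finset.range (z + 1), (sigma 1 i : ZMod 2) := by
    have h := mul_cubicPartition_eq_sum_antidiagonal (N + z)
    rw [hone, mul_one, ← Finset.Nat.sum_antidiagonal_swap] at h
    simp only [Prod.fst_swap, Prod.snd_swap] at h
    rw [Finset.Nat.sum_antidiagonal_eq_sum_range_succ
      fun i j ↦ (sigma 1 j : ZMod 2) * cubicPartition i, Nat.succ_eq_add_one, add_assoc,
      Finset.sum_range_add, Finset.sum_eq_zero, zero_add] at h
    · rw [h, ← Finset.sum_range_reflect]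
      refine Finset.sum_congr rfl fun i hi ↦ ?_
      rw [hone, mul_one]
      have := Finset.mem_range.1 hi
      congr 2
      omega
    · intro j hj
      rw [hz j (Finset.mem_range.1 hj), zero_mul]
  have h₀ := hsum y fun j hj ↦ by
    convert hzero (N - j - 1) (by omega) using 3
    omega
  have h₁ := hsum (y + 1) fun j hj ↦ by
    convert hzero (N - j) (by omega) using 3
    omega
  have hlast := hzero 0 N.zero_le
  rw [Finset.sum_range_succ, ← h₀] at h₁
  rw [add_zero] at hlast
  rw [hlast, ← add_assoc, Nat.cast_succ, add_zero] at h₁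
  exact one_ne_zero (left_eq_add.1 h₁.symm)
end
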